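/- arXiv:2409.10051 — 2 statements merged into one kernel-verified Lean document; each statement's English description precedes it below -/
import Mathlib

section
/- Let (𝒫, 𝒩) be a Beurling generalized number system whose integers are θ-well-behaved for some θ ∈ [0,1). Suppose that for every ε > 0 there is a constant C_ε such that for all complex coefficients a_j with |a_j| ≤ 1, all N ≥ 2, all T_0 ∈ ℝ, T > 0, and uniformly for ν ∈ [1,2]: ∫_{T_0}^{T_0+T} |∑_{n_j ≤ N} a_j n_j^{−it}|^{2ν} dt ≤ C_ε (T N^{νθ} + N^ν) N^{ν+ε}. Then for every ε > 0, N(ζ_𝒫; α, T) ≪_ε T^{2(1−α)/(1−θ)+ε} uniformly for α ≥ (1+θ)/2 and T ≥ 2. -/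
open Filter Asymptotics

/-- A Beurling generalized number system: a nondecreasing sequence of generalized
primes `p` with `1 < p 0` tending to infinity, together with the nondecreasing
enumeration `n` (with multiplicity) of all finite products of the generalized primes,
witnessed by the bijection `equiv` from exponent vectors to indices. -/
structure BeurlingSystem where
  p : ℕ → ℝ
  n : ℕ → ℝ
  one_lt_p : 1 < p 0
  mono_p : Monotone p
  tendsto_p : Tendsto p atTop atTop
  mono_n : Monotone n
  equiv : (ℕ →₀ ℕ) ≃ ℕ
  n_eq : ∀ k : ℕ →₀ ℕ, n (equiv k) = ∏ j ∈ k.support, p j ^ k j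

/-- The integer counting function `N_𝒫(x)`. -/
noncomputable def BeurlingSystem.Nint (S : BeurlingSystem) (x : ℝ) : ℕ :=
  {j : ℕ | S.n j ≤ x}.ncard

/-- `Z` is an analytic continuation of the Beurling zeta function of the system `S`
to the half-plane `Re s > θ`, with density `A`: it agrees with the Dirichlet series
on `Re s > 1` and `Z s - A/(s-1)` is analytic on `Re s > θ`. -/
def BeurlingSystem.IsZeta (S : BeurlingSystem) (θ A : ℝ) (Z : ℂ → ℂ) : Prop :=
  (∀ s : ℂ, 1 < s.re → Z s = ∑' j : ℕ, (S.n j : ℂ) ^ (-s)) ∧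
    DifferentiableOn ℂ (fun s => Z s - (A : ℂ) / (s - 1)) {s : ℂ | θ < s.re}

/-- The number of zeros (without multiplicity) of `Z` with `α ≤ Re ρ` and `|Im ρ| ≤ T`. -/
noncomputable def zeroCount (Z : ℂ → ℂ) (α T : ℝ) : ℕ :=
  {ρ : ℂ | Z ρ = 0 ∧ α ≤ ρ.re ∧ |ρ.im| ≤ T}.ncard

section

open Filter Asymptotics

namespace BeurlingSystem

open Finset.HasAntidiagonal

/-- The generalized integer attached to an exponent vector. -/
noncomputable def weight (S : BeurlingSystem) (k : ℕ →₀ ℕ) : ℝ := S.n (S.equiv k)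

variable (S : BeurlingSystem)

lemma weight_eq_prod (k : ℕ →₀ ℕ) : S.weight k = k.prod fun j a => S.p j ^ a := S.n_eq k

lemma one_lt_prime (j : ℕ) : 1 < S.p j := S.one_lt_p.trans_le (S.mono_p (Nat.zero_le j))

lemma weight_zero : S.weight 0 = 1 := by
  rw [weight_eq_prod, Finsupp.prod_zero_index]

lemma weight_add (k l : ℕ →₀ ℕ) : S.weight (k + l) = S.weight k * S.weight l := by
  simp only [weight_eq_prod]
  exact Finsupp.prod_add_index' (by simp) (by intros; rw [pow_add])

lemma one_le_weight (k : ℕ →₀ ℕ) : 1 ≤ S.weight k := by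
  rw [weight_eq_prod, Finsupp.prod]
  exact Finset.prod_induction _ (fun x : ℝ => 1 ≤ x) (fun _ _ => one_le_mul_of_one_le_of_one_le) le_rfl
    fun j _ => one_le_pow₀ (S.one_lt_prime j).le

lemma weight_pos (k : ℕ →₀ ℕ) : 0 < S.weight k := one_pos.trans_le (S.one_le_weight k)

lemma n_eq_weight (j : ℕ) : S.n j = S.weight (S.equiv.symm j) := by simp [weight]

lemma image_setOf_weight_le (x : ℝ) : S.equiv '' {k | S.weight k ≤ x} = {j | S.n j ≤ x} := by
  ext j
  constructor
  · rintro ⟨k, hk, rfl⟩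
    exact hk
  · intro hj
    exact ⟨S.equiv.symm j, by simpa [weight] using hj, by simp⟩

lemma Nint_eq_ncard (x : ℝ) : S.Nint x = {k | S.weight k ≤ x}.ncard := by
  rw [Nint, ← image_setOf_weight_le, Set.ncard_image_of_injective _ S.equiv.injective]

variable {S} {θ A : ℝ}

lemma finite_setOf_n_le (hθ1 : θ < 1) (hA : 0 < A)
    (hwb : (fun x : ℝ => (S.Nint x : ℝ) - A * x) =O[atTop] fun x : ℝ => x ^ θ) (x : ℝ) :
    {j | S.n j ≤ x}.Finite := by
  by_contra hinf
  obtain ⟨C, hC⟩ := hwb.bound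
  have h1 : ∀ᶠ y : ℝ in atTop, y ^ (1 - θ) ≤ C / A := by
    filter_upwards [hC, eventually_ge_atTop x, eventually_gt_atTop 0] with y hy hxy hy0
    have : S.Nint y = 0 := by
      apply Set.Infinite.ncard
      exact Set.Infinite.mono (fun j (hj : S.n j ≤ x) => hj.trans hxy) hinf
    rw [this, Real.norm_of_nonneg (Real.rpow_nonneg hy0.le _)] at hy
    simp only [CharP.cast_eq_zero, zero_sub, norm_neg, norm_mul, Real.norm_eq_abs,
      abs_of_pos hA, abs_of_pos hy0] at hy
    rw [Real.rpow_sub hy0, Real.rpow_one, div_le_div_iff₀ (Real.rpow_pos_of_pos hy0 _) hA]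
    linarith
  have h2 := (tendsto_rpow_atTop (sub_pos.2 hθ1)).eventually_gt_atTop (C / A)
  obtain ⟨y, hy1, hy2⟩ := (h1.and h2).exists
  exact absurd hy1 (not_le.2 hy2)

lemma finite_setOf_weight_le (hfin : ∀ x, {j | S.n j ≤ x}.Finite) (x : ℝ) :
    {k | S.weight k ≤ x}.Finite := by
  have := hfin x
  rw [← image_setOf_weight_le] at this
  exact this.of_finite_image S.equiv.injective.injOn

lemma Nint_mono (hfin : ∀ x, {j | S.n j ≤ x}.Finite) : Monotone S.Nint := fun _ y hxy =>
  Set.ncard_le_ncard (fun _ hj => le_trans hj hxy) (hfin y)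

lemma exists_abs_Nint_sub_le (hθ0 : 0 ≤ θ) (hA : 0 < A) (hfin : ∀ x, {j | S.n j ≤ x}.Finite)
    (hwb : (fun x : ℝ => (S.Nint x : ℝ) - A * x) =O[atTop] fun x : ℝ => x ^ θ) :
    ∃ C > 0, ∀ u : ℝ, 1 ≤ u → |(S.Nint u : ℝ) - A * u| ≤ C * u ^ θ := by
  obtain ⟨C, hC⟩ := hwb.bound
  obtain ⟨u₀, hu₀⟩ := eventually_atTop.1 hC
  refine ⟨max C 0 + S.Nint u₀ + A * |u₀| + 1, by positivity, fun u hu => ?_⟩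
  have hu1 : 1 ≤ u ^ θ := Real.one_le_rpow hu hθ0
  have hC0 : 0 ≤ max C 0 := le_max_right _ _
  have hN : (0 : ℝ) ≤ S.Nint u₀ := by positivity
  have hAu : 0 ≤ A * |u₀| := by positivity
  rcases le_total u₀ u with h | h
  · have h1 := hu₀ u h
    rw [Real.norm_eq_abs, Real.norm_of_nonneg (by positivity)] at h1
    refine h1.trans ?_
    gcongr
    linarith [le_max_left C 0]
  · have h1 : (S.Nint u : ℝ) ≤ S.Nint u₀ := by exact_mod_cast Nint_mono hfin h
    have h2 : A * u ≤ A * |u₀| := by gcongr; exact h.trans (le_abs_self _)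
    have h3 : 0 ≤ A * u := by positivity
    have h4 : (0 : ℝ) ≤ S.Nint u := by positivity
    calc |(S.Nint u : ℝ) - A * u| ≤ max C 0 + S.Nint u₀ + A * |u₀| + 1 := by
          rw [abs_le]; constructor <;> linarith
      _ ≤ _ := le_mul_of_one_le_right (by positivity) hu1

lemma exists_Nint_le (hθ1 : θ < 1) (hA : 0 < A) {C : ℝ} (hC : 0 < C)
    (hE : ∀ u : ℝ, 1 ≤ u → |(S.Nint u : ℝ) - A * u| ≤ C * u ^ θ) :
    ∃ D > 0, ∀ u : ℝ, 1 ≤ u → (S.Nint u : ℝ) ≤ D * u := by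
  refine ⟨A + C, by positivity, fun u hu => ?_⟩
  have h1 := (abs_le.1 (hE u hu)).2
  have h2 : u ^ θ ≤ u := by
    simpa using Real.rpow_le_rpow_of_exponent_le hu hθ1.le
  nlinarith

lemma summable_weight_rpow (hfin : ∀ x, {j | S.n j ≤ x}.Finite) {D : ℝ} (hD : 0 < D)
    (hN : ∀ u : ℝ, 1 ≤ u → (S.Nint u : ℝ) ≤ D * u) {σ : ℝ} (hσ : 1 < σ) :
    Summable fun k => S.weight k ^ (-σ) := by
  rw [← S.equiv.symm.summable_iff]
  have hcomp : ((fun k => S.weight k ^ (-σ)) ∘ S.equiv.symm) = fun j => S.n j ^ (-σ) := by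
    ext j; simp [weight]
  rw [hcomp]
  have h1 : ∀ j : ℕ, ((j : ℝ) + 1) / D ≤ S.n j := by
    intro j
    have hle : j + 1 ≤ S.Nint (S.n j) := by
      have hsub : (Finset.range (j + 1) : Set ℕ) ⊆ {i | S.n i ≤ S.n j} := by
        intro i hi
        exact S.mono_n (by simpa [Nat.lt_succ_iff] using hi)
      have := Set.ncard_le_ncard hsub (hfin _)
      rwa [Set.ncard_coe_finset, Finset.card_range] at this
    have h2 := hN (S.n j) (by rw [n_eq_weight]; exact S.one_le_weight _)
    rw [div_le_iff₀ hD, mul_comm]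
    refine le_trans ?_ h2
    exact_mod_cast hle
  have h2 : Summable fun j : ℕ => D ^ σ * (1 / |(j : ℝ) + 1| ^ σ) :=
    ((Real.summable_one_div_nat_add_rpow 1 σ).2 hσ).mul_left _
  refine Summable.of_nonneg_of_le (fun j => ?_) (fun j => ?_) h2
  · rw [n_eq_weight]; exact Real.rpow_nonneg (S.weight_pos _).le _
  · have hj : (0 : ℝ) < j + 1 := by positivity
    calc S.n j ^ (-σ) ≤ (((j : ℝ) + 1) / D) ^ (-σ) :=
          Real.rpow_le_rpow_of_nonpos (by positivity) (h1 j) (by linarith)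
      _ = _ := by
        rw [abs_of_pos hj, Real.rpow_neg (by positivity), Real.div_rpow hj.le hD.le, inv_div,
          div_eq_mul_one_div]

open scoped Classical in
/-- The Möbius function on exponent vectors. -/
noncomputable def mobius (k : ℕ →₀ ℕ) : ℂ :=
  if ∀ j, k j ≤ 1 then (-1) ^ k.degree else 0

lemma norm_mobius_le (k : ℕ →₀ ℕ) : ‖mobius k‖ ≤ 1 := by
  unfold mobius
  split_ifs <;> simp

lemma mobius_add_single {k : ℕ →₀ ℕ} {j : ℕ} (h : k j = 0) :
    mobius (k + Finsupp.single j 1) = -mobius k := by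
  unfold mobius
  have : (∀ i, (k + Finsupp.single j 1 : ℕ →₀ ℕ) i ≤ 1) ↔ ∀ i, k i ≤ 1 := by
    refine forall_congr' fun i => ?_
    by_cases hij : i = j
    · subst hij; simp [h]
    · simp [Ne.symm hij]
  by_cases hk : ∀ i, k i ≤ 1
  · rw [if_pos (this.2 hk), if_pos hk]
    simp [pow_succ]
  · rw [if_neg (fun h => hk (this.1 h)), if_neg hk, neg_zero]

lemma sum_antidiagonal_mobius {n : ℕ →₀ ℕ} (hn : n ≠ 0) :
    ∑ d ∈ antidiagonal n, mobius d.1 = 0 := by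
  classical
  obtain ⟨j, hj⟩ := Finsupp.support_nonempty_iff.2 hn
  rw [Finsupp.mem_support_iff] at hj
  let δ : ℕ →₀ ℕ := Finsupp.single j 1
  have hδ : ∀ k : ℕ →₀ ℕ, k j ≠ 0 → k - δ + δ = k := fun k hk => by
    ext i
    by_cases hij : i = j
    · subst hij; simp [δ]; omega
    · simp [δ, Ne.symm hij]
  have hδ' : ∀ k : ℕ →₀ ℕ, k + δ - δ = k := fun k => by simp
  have hval : ∀ k : ℕ →₀ ℕ, (k + δ) j = k j + 1 := fun k => by simp [δ]
  have hval' : ∀ k : ℕ →₀ ℕ, (k - δ) j = k j - 1 := fun k => by simp [δ]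
  let g : (ℕ →₀ ℕ) × (ℕ →₀ ℕ) → (ℕ →₀ ℕ) × (ℕ →₀ ℕ) := fun d =>
    if d.1 j = 0 then (d.1 + δ, d.2 - δ) else if d.1 j = 1 then (d.1 - δ, d.2 + δ) else d
  have key : ∀ d ∈ antidiagonal n, d.1 j = 0 → d.2 j ≠ 0 := by
    intro d hd h0
    rw [mem_antidiagonal] at hd
    have := DFunLike.congr_fun hd j
    simp only [Finsupp.add_apply] at this
    omega
  refine Finset.sum_involution (fun d _ => g d) ?_ ?_ ?_ ?_
  · intro d hd
    by_cases h0 : d.1 j = 0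
    · simp only [g, h0, if_true]
      rw [mobius_add_single h0]; ring
    · by_cases h1 : d.1 j = 1
      · simp only [g, h1]
        have h2 : mobius (d.1 - δ + δ) = -mobius (d.1 - δ) :=
          mobius_add_single (by rw [hval', h1])
        rw [hδ _ h0] at h2
        simp [h2]
      · have : mobius d.1 = 0 := by
          unfold mobius
          rw [if_neg]
          intro h
          have := h j
          omega
        simp [g, h0, h1, this]
  · intro d hd hne heq
    by_cases h0 : d.1 j = 0
    · have := congrArg (fun d : (ℕ →₀ ℕ) × (ℕ →₀ ℕ) => d.1 j) heq
      simp [g, h0, hval] at this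
    · by_cases h1 : d.1 j = 1
      · have := congrArg (fun d : (ℕ →₀ ℕ) × (ℕ →₀ ℕ) => d.1 j) heq
        simp [g, h1, hval'] at this
      · apply hne
        unfold mobius
        rw [if_neg]
        intro h
        have := h j
        omega
  · intro d hd
    have hd' := mem_antidiagonal.1 hd
    rw [mem_antidiagonal]
    by_cases h0 : d.1 j = 0
    · simp only [g, h0, if_true]
      rw [add_assoc, add_comm δ, hδ _ (key d hd h0), hd']
    · by_cases h1 : d.1 j = 1
      · simp only [g, h1]
        simp only [one_ne_zero, if_false, if_true]
        rw [add_comm d.2, ← add_assoc, hδ _ h0, hd']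
      · simpa [g, h0, h1] using hd'
  · intro d hd
    by_cases h0 : d.1 j = 0
    · have h2 := hδ _ (key d hd h0)
      simp [g, h0, hval, h2]
    · by_cases h1 : d.1 j = 1
      · have h2 := hδ _ h0
        simp [g, h1, hval', h2]
      · simp [g, h0, h1]

lemma card_antidiagonal_le (n : ℕ →₀ ℕ) :
    (antidiagonal n).card ≤ ∏ j ∈ n.support, (n j + 1) := by
  classical
  have h1 : (antidiagonal n).card ≤ (Finset.Iic n).card := by
    refine Finset.card_le_card_of_injOn Prod.fst ?_ ?_
    · intro d hd
      have hd := mem_antidiagonal.1 (Finset.mem_coe.1 hd)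
      simp only [Finset.coe_Iic, Set.mem_Iic]
      exact hd ▸ le_self_add
    · intro d hd e he hde
      have hd := mem_antidiagonal.1 (Finset.mem_coe.1 hd)
      have he := mem_antidiagonal.1 (Finset.mem_coe.1 he)
      refine Prod.ext hde ?_
      rw [← he, hde] at hd
      exact add_left_cancel hd
  rw [Finsupp.card_Iic] at h1
  simpa using h1

/-- The divisor bound. -/
lemma exists_card_antidiagonal_le (S : BeurlingSystem) {η : ℝ} (hη : 0 < η) :
    ∃ C : ℝ, 1 ≤ C ∧ ∀ n : ℕ →₀ ℕ, ((antidiagonal n).card : ℝ) ≤ C * S.weight n ^ η := by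
  obtain ⟨J, hJ⟩ := eventually_atTop.1
    (((tendsto_rpow_atTop hη).comp S.tendsto_p).eventually_ge_atTop 2)
  have hy : ∀ j, 1 < S.p j ^ η := fun j => Real.one_lt_rpow (S.one_lt_prime j) hη
  set y₀ := S.p 0 ^ η with hy₀
  set c := max 1 (1 / (y₀ - 1)) with hc
  have hc1 : 1 ≤ c := le_max_left _ _
  have hy0 : 0 < y₀ - 1 := sub_pos.2 (hy 0)
  have hmul : ∀ j a : ℕ, ((a : ℝ) + 1) ≤ (if j < J then c else 1) * (S.p j ^ η) ^ a := by
    intro j a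
    split_ifs with h
    · have h1 : y₀ ^ a ≤ (S.p j ^ η) ^ a := by
        have := S.one_lt_prime 0
        have h0 : y₀ ≤ S.p j ^ η :=
          Real.rpow_le_rpow (by positivity) (S.mono_p (Nat.zero_le j)) hη.le
        have := hy 0
        gcongr
      have h2 := one_add_mul_le_pow (a := y₀ - 1) (by linarith) a
      rw [add_sub_cancel] at h2
      have h3 : 1 ≤ c * (y₀ - 1) := by
        calc (1 : ℝ) = 1 / (y₀ - 1) * (y₀ - 1) := by field_simp
          _ ≤ _ := by gcongr; exact le_max_right _ _
      calc (a : ℝ) + 1 ≤ c * (1 + a * (y₀ - 1)) := by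
            have : (0 : ℝ) ≤ a := by positivity
            nlinarith
        _ ≤ c * y₀ ^ a := by gcongr
        _ ≤ _ := by gcongr
    · have h2 : (2 : ℝ) ^ a ≤ (S.p j ^ η) ^ a := by
        gcongr
        exact hJ j (not_lt.1 h)
      have h3 : (a : ℝ) + 1 ≤ 2 ^ a := by exact_mod_cast Nat.lt_two_pow_self
      linarith
  refine ⟨c ^ J, one_le_pow₀ hc1, fun n => ?_⟩
  calc ((antidiagonal n).card : ℝ) ≤ ∏ j ∈ n.support, ((n j : ℝ) + 1) := by
        exact_mod_cast card_antidiagonal_le n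
    _ ≤ ∏ j ∈ n.support, ((if j < J then c else 1) * (S.p j ^ η) ^ n j) :=
        Finset.prod_le_prod (fun _ _ => by positivity) fun j _ => hmul j _
    _ = (∏ j ∈ n.support, if j < J then c else 1) * ∏ j ∈ n.support, (S.p j ^ η) ^ n j :=
        Finset.prod_mul_distrib
    _ ≤ c ^ J * S.weight n ^ η := by
        have h1 : (∏ j ∈ n.support, if j < J then c else 1) ≤ c ^ J := by
          rw [← Finset.prod_filter, Finset.prod_const]
          refine pow_le_pow_right₀ hc1 ?_
          calc _ ≤ (Finset.range J).card := Finset.card_le_card fun j hj => by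
                simpa using (Finset.mem_filter.1 hj).2
            _ = J := Finset.card_range J
        have h2 : ∏ j ∈ n.support, (S.p j ^ η) ^ n j = S.weight n ^ η := by
          rw [weight_eq_prod, Finsupp.prod, ← Real.finsetProd_rpow]
          · refine Finset.prod_congr rfl fun j _ => ?_
            rw [← Real.rpow_natCast, ← Real.rpow_mul, mul_comm, Real.rpow_mul, Real.rpow_natCast]
            all_goals exact (one_pos.trans (S.one_lt_prime j)).le
          · intro j _
            have := S.one_lt_prime j
            positivity
        rw [h2]
        have := S.weight_pos n
        gcongr

lemma norm_weight_cpow (S : BeurlingSystem) (k : ℕ →₀ ℕ) (s : ℂ) :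
    ‖(S.weight k : ℂ) ^ (-s)‖ = S.weight k ^ (-s.re) := by
  rw [Complex.norm_cpow_eq_rpow_re_of_pos (S.weight_pos k), Complex.neg_re]

lemma weight_add_cpow (S : BeurlingSystem) (k l : ℕ →₀ ℕ) (s : ℂ) :
    (S.weight (k + l) : ℂ) ^ s = (S.weight k : ℂ) ^ s * (S.weight l : ℂ) ^ s := by
  rw [weight_add, Complex.ofReal_mul,
    Complex.mul_cpow_ofReal_nonneg (S.weight_pos k).le (S.weight_pos l).le]

lemma one_le_norm_mul_tsum (hS : ∀ σ : ℝ, 1 < σ → Summable fun k => S.weight k ^ (-σ)) {s : ℂ}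
    (hs : 1 < s.re) :
    1 ≤ ‖∑' k, (S.weight k : ℂ) ^ (-s)‖ * ∑' k, S.weight k ^ (-s.re) := by
  classical
  have h1 : Summable fun k => ‖(S.weight k : ℂ) ^ (-s)‖ := by
    simpa only [norm_weight_cpow] using hS s.re hs
  have hle : ∀ k, ‖mobius k * (S.weight k : ℂ) ^ (-s)‖ ≤ ‖(S.weight k : ℂ) ^ (-s)‖ := fun k => by
    rw [norm_mul]
    exact mul_le_of_le_one_left (norm_nonneg _) (norm_mobius_le k)
  have h2 : Summable fun k => ‖mobius k * (S.weight k : ℂ) ^ (-s)‖ :=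
    Summable.of_nonneg_of_le (fun _ => norm_nonneg _) hle h1
  have h4 : ∀ n : ℕ →₀ ℕ, ∑ kl ∈ antidiagonal n,
      mobius kl.1 * (S.weight kl.1 : ℂ) ^ (-s) * (S.weight kl.2 : ℂ) ^ (-s)
        = if n = 0 then 1 else 0 := by
    intro n
    have : ∑ kl ∈ antidiagonal n,
      mobius kl.1 * (S.weight kl.1 : ℂ) ^ (-s) * (S.weight kl.2 : ℂ) ^ (-s)
        = (∑ kl ∈ antidiagonal n, mobius kl.1) * (S.weight n : ℂ) ^ (-s) := by
      rw [Finset.sum_mul]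
      refine Finset.sum_congr rfl fun d hd => ?_
      rw [← mem_antidiagonal.1 hd, weight_add_cpow, mul_assoc]
    rw [this]
    split_ifs with hn
    · subst hn
      simp [weight_zero, mobius]
    · rw [sum_antidiagonal_mobius hn, zero_mul]
  have h3 : (∑' k, mobius k * (S.weight k : ℂ) ^ (-s)) * ∑' k, (S.weight k : ℂ) ^ (-s) = 1 := by
    have h6 := summable_mul_of_summable_norm h2 h1
    refine (h2.of_norm.tsum_mul_tsum_eq_tsum_sum_antidiagonal h1.of_norm h6).trans ?_
    rw [tsum_congr h4]
    exact tsum_ite_eq 0 1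
  have h5 : ‖∑' k, mobius k * (S.weight k : ℂ) ^ (-s)‖ ≤ ∑' k, S.weight k ^ (-s.re) := by
    refine (norm_tsum_le_tsum_norm h2).trans ?_
    simp only [← norm_weight_cpow]
    exact h2.tsum_le_tsum hle h1
  calc (1 : ℝ) = ‖(∑' k, mobius k * (S.weight k : ℂ) ^ (-s)) * ∑' k, (S.weight k : ℂ) ^ (-s)‖ := by
        rw [h3, norm_one]
    _ = ‖∑' k, (S.weight k : ℂ) ^ (-s)‖ * ‖∑' k, mobius k * (S.weight k : ℂ) ^ (-s)‖ := by
        rw [norm_mul, mul_comm]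
    _ ≤ _ := by gcongr

end BeurlingSystem

end

section

open MeasureTheory FourierTransform
open scoped ContDiff

theorem ae_eq_fourier_toLp {f : ℝ → ℂ} (h1 : Integrable f) (h2 : MemLp f 2) :
    ((𝓕 (h2.toLp f) : Lp ℂ 2 (volume : Measure ℝ)) : ℝ → ℂ) =ᵐ[volume] 𝓕 f := by
  have hcont : Continuous (𝓕 f) :=
    VectorFourier.fourierIntegral_continuous Real.continuous_fourierChar
      (by exact continuous_inner) h1
  refine ae_eq_of_integral_contDiff_smul_eq
    ((Lp.memLp _).locallyIntegrable (by norm_num)) hcont.locallyIntegrable fun g hg hgc => ?_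
  have hg₁ : HasCompactSupport (Complex.ofRealCLM ∘ g) := hgc.comp_left rfl
  have hg₂ : ContDiff ℝ ∞ (Complex.ofRealCLM ∘ g) := by fun_prop
  set G := hg₁.toSchwartzMap hg₂ with hG
  have e1 : ∫ x, g x • ((𝓕 (h2.toLp f) : Lp ℂ 2 (volume : Measure ℝ)) : ℝ → ℂ) x
      = Lp.toTemperedDistributionCLM ℂ (volume : Measure ℝ) 2 (𝓕 (h2.toLp f)) G := by
    simp [Lp.toTemperedDistribution_apply, hG]
  have e2 : Lp.toTemperedDistributionCLM ℂ (volume : Measure ℝ) 2 (𝓕 (h2.toLp f)) G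
      = Lp.toTemperedDistributionCLM ℂ (volume : Measure ℝ) 2 (h2.toLp f) (𝓕 G) := by
    simp only [Lp.toTemperedDistributionCLM_apply]
    rw [← MeasureTheory.Lp.fourier_toTemperedDistribution_eq]
    rfl
  rw [e1, e2, Lp.toTemperedDistributionCLM_apply, 
    Lp.toTemperedDistribution_apply (μ := (volume : Measure ℝ)) (p := 2) (h2.toLp f)]
  have e3 : ∫ x, (𝓕 G : SchwartzMap ℝ ℂ) x • (h2.toLp f : ℝ → ℂ) x =
      ∫ x, (𝓕 G : SchwartzMap ℝ ℂ) x • f x := by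
    refine integral_congr_ae ?_
    filter_upwards [h2.coeFn_toLp] with x hx
    rw [hx]
  rw [e3]
  have e4 : ∫ x, (𝓕 G : SchwartzMap ℝ ℂ) x • f x = ∫ x, G x • 𝓕 f x := by
    have := VectorFourier.integral_bilin_fourierIntegral_eq_flip (μ := volume) (ν := volume)
      (ContinuousLinearMap.lsmul ℂ ℂ : ℂ →L[ℂ] ℂ →L[ℂ] ℂ)
      (L := innerₗ ℝ) Real.continuous_fourierChar continuous_inner (G.integrable (μ := volume)) h1
    simpa using! this
  rw [e4]
  simp [hG]

theorem integral_norm_sq_fourier_eq {f : ℝ → ℂ} (h1 : Integrable f) (h2 : MemLp f 2) :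
    Integrable (fun x => ‖𝓕 f x‖ ^ 2) ∧ ∫ x, ‖𝓕 f x‖ ^ 2 = ∫ x, ‖f x‖ ^ 2 := by
  have hae := ae_eq_fourier_toLp h1 h2
  have hm : MemLp (𝓕 f) 2 := (memLp_congr_ae hae).1 (Lp.memLp _)
  have hn := MeasureTheory.Lp.norm_fourier_eq (h2.toLp f)
  have key : ∀ F : Lp ℂ 2 (volume : Measure ℝ), ‖F‖ ^ 2 = ∫ x, ‖F x‖ ^ 2 := by
    intro F
    have := @L2.inner_def ℝ ℂ ℂ _ _ _ _ _ F F
    rw [inner_self_eq_norm_sq_to_K (𝕜 := ℂ)] at this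
    have h' : ∫ a, inner ℂ (F a) (F a) = ∫ x, ((‖F x‖ ^ 2 : ℝ) : ℂ) := by
      refine integral_congr_ae (.of_forall fun x => ?_)
      simp only [inner_self_eq_norm_sq_to_K (𝕜 := ℂ)]
      simp
    rw [h', integral_complex_ofReal] at this
    norm_cast at this
    exact Complex.ofReal_injective this
  refine ⟨(memLp_two_iff_integrable_sq_norm hm.1).1 hm, ?_⟩
  have a1 : ∫ x, ‖𝓕 f x‖ ^ 2 = ‖𝓕 (h2.toLp f)‖ ^ 2 := by
    rw [key]
    refine integral_congr_ae ?_
    filter_upwards [hae] with x hx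
    rw [hx]
  have a2 : ∫ x, ‖f x‖ ^ 2 = ‖h2.toLp f‖ ^ 2 := by
    rw [key]
    refine integral_congr_ae ?_
    filter_upwards [h2.coeFn_toLp] with x hx
    rw [hx]
  rw [a1, a2, hn]

end

section

open MeasureTheory Metric

theorem integral_Ioo_circleMap {f : ℂ → ℂ} {c : ℂ} {s : ℝ} (hs : 0 ≤ s)
    (hf : DifferentiableOn ℂ f (closedBall c s)) :
    ∫ φ in Set.Ioo (-Real.pi) Real.pi, f (circleMap c s φ) = (2 * Real.pi : ℝ) • f c := by
  have h1 : Real.circleAverage f c s = f c := by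
    refine DiffContOnCl.circleAverage ?_
    rw [abs_of_nonneg hs]
    exact hf.diffContOnCl_ball subset_rfl
  have hper : (fun φ => f (circleMap c s φ)).Periodic (2 * Real.pi) := fun φ => by
    simp [periodic_circleMap c s φ]
  have h2 := hper.intervalIntegral_add_eq (-Real.pi) 0
  rw [show -Real.pi + 2 * Real.pi = Real.pi by ring, zero_add] at h2
  rw [← integral_Ioc_eq_integral_Ioo, ← intervalIntegral.integral_of_le (by
    linarith [Real.pi_pos]), h2, ← h1, Real.circleAverage_def, smul_smul,
    mul_inv_cancel₀ (by positivity), one_smul]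

theorem setIntegral_ball_eq {f : ℂ → ℂ} {c : ℂ} {r : ℝ} (hr : 0 < r)
    (hf : DifferentiableOn ℂ f (closedBall c r)) :
    ∫ z in ball c r, f z = (Real.pi * r ^ 2 : ℝ) • f c := by
  have hcm : ∀ p : ℝ × ℝ, c + Complex.polarCoord.symm p = circleMap c p.1 p.2 := fun p => by
    rw [Complex.polarCoord_symm_apply, circleMap, Complex.exp_mul_I]
    simp
  have h1 : ∫ z in ball c r, f z = ∫ z, (ball (0:ℂ) r).indicator (fun z => f (c + z)) z := by
    rw [← integral_indicator measurableSet_ball, ← integral_add_left_eq_self _ c]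
    congr 1
    ext z
    simp [Set.indicator]
  rw [h1, ← Complex.integral_comp_polarCoord_symm]
  have h2 : ∫ p in polarCoord.target, p.1 • (ball (0:ℂ) r).indicator (fun z => f (c + z))
      (Complex.polarCoord.symm p) = ∫ p in Set.Ioo 0 r ×ˢ Set.Ioo (-Real.pi) Real.pi,
        p.1 • f (circleMap c p.1 p.2) := by
    rw [← integral_indicator (by measurability), ← integral_indicator (by measurability)]
    congr 1
    ext1 p
    have hb : (Complex.polarCoord.symm p ∈ ball (0:ℂ) r) ↔ |p.1| < r := by
      rw [mem_ball_zero_iff, Complex.norm_polarCoord_symm]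
    simp only [Set.indicator, hb, polarCoord_target, Set.mem_prod, Set.mem_Ioi, Set.mem_Ioo, hcm]
    grind [abs_of_pos, smul_zero]
  have hintegral : IntegrableOn (fun p : ℝ × ℝ => p.1 • f (circleMap c p.1 p.2))
      (Set.Ioo 0 r ×ˢ Set.Ioo (-Real.pi) Real.pi) := by
    refine IntegrableOn.mono_set (t := Set.Icc 0 r ×ˢ Set.Icc (-Real.pi) Real.pi) ?_
      (Set.prod_mono Set.Ioo_subset_Icc_self Set.Ioo_subset_Icc_self)
    refine ContinuousOn.integrableOn_compact (isCompact_Icc.prod isCompact_Icc) ?_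
    refine continuousOn_fst.smul (hf.continuousOn.comp ?_ ?_)
    · unfold circleMap
      fun_prop
    · rintro ⟨s, φ⟩ ⟨hs, -⟩
      simp only [mem_closedBall, dist_eq_norm, circleMap_sub_center, norm_circleMap_zero]
      rw [abs_of_nonneg hs.1]
      exact hs.2
  rw [h2, Measure.volume_eq_prod, setIntegral_prod _ hintegral]
  have h3 : ∀ s ∈ Set.Ioo 0 r, ∫ φ in Set.Ioo (-Real.pi) Real.pi, s • f (circleMap c s φ) =
      s • (2 * Real.pi : ℝ) • f c := fun s hs => by
    rw [integral_smul, integral_Ioo_circleMap hs.1.le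
      (hf.mono (closedBall_subset_closedBall hs.2.le))]
  rw [setIntegral_congr_fun measurableSet_Ioo h3, integral_smul_const,
    ← integral_Ioc_eq_integral_Ioo, ← intervalIntegral.integral_of_le hr.le, integral_id,
    smul_smul]
  congr 1
  ring

theorem norm_rpow_le_setIntegral_ball {f : ℂ → ℂ} {c : ℂ} {r p : ℝ} (hr : 0 < r) (hp : 1 ≤ p)
    (hf : DifferentiableOn ℂ f (closedBall c r)) :
    ‖f c‖ ^ p ≤ (Real.pi * r ^ 2)⁻¹ * ∫ z in ball c r, ‖f z‖ ^ p := by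
  have hvol : (volume.real (ball c r)) = Real.pi * r ^ 2 := by
    rw [Measure.real, Complex.volume_ball]
    simp [hr.le, mul_comm]
  have hπ : 0 < Real.pi * r ^ 2 := by positivity
  have hcn : ContinuousOn (fun z => ‖f z‖) (closedBall c r) := hf.continuousOn.norm
  have hcp : ContinuousOn (fun z => ‖f z‖ ^ p) (closedBall c r) :=
    hcn.rpow_const fun _ _ => Or.inr (by linarith)
  have hi : IntegrableOn (fun z => ‖f z‖) (ball c r) :=
    (hcn.integrableOn_compact (isCompact_closedBall c r)).mono_set ball_subset_closedBall
  have hip : IntegrableOn (fun z => ‖f z‖ ^ p) (ball c r) :=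
    (hcp.integrableOn_compact (isCompact_closedBall c r)).mono_set ball_subset_closedBall
  have hle : ‖f c‖ ≤ ⨍ z in ball c r, ‖f z‖ := by
    have := norm_integral_le_integral_norm (μ := volume.restrict (ball c r)) f
    rw [setIntegral_ball_eq hr hf, norm_smul, Real.norm_of_nonneg hπ.le] at this
    rw [setAverage_eq, hvol, smul_eq_mul, ← div_eq_inv_mul, le_div_iff₀ hπ, mul_comm]
    exact this
  calc ‖f c‖ ^ p ≤ (⨍ z in ball c r, ‖f z‖) ^ p := by gcongr
    _ ≤ ⨍ z in ball c r, ‖f z‖ ^ p := by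
      refine (convexOn_rpow hp).map_set_average_le (t := ball c r) (f := fun z => ‖f z‖)
        (Real.continuous_rpow_const (by linarith)).continuousOn
        isClosed_Ici (measure_ball_pos _ _ hr).ne' measure_ball_lt_top.ne
        (.of_forall fun z => norm_nonneg _) hi hip
    _ = _ := by rw [setAverage_eq, hvol, smul_eq_mul]

end

section

open MeasureTheory Metric

theorem setIntegral_reProdIm_le {g : ℂ → ℝ} {a b c d I : ℝ} (hab : a ≤ b) (hcd : c ≤ d)
    (hg : ContinuousOn g (Set.Icc a b ×ℂ Set.Icc c d))
    (hI : ∀ σ ∈ Set.Icc a b, ∫ t in c..d, g (σ + t * Complex.I) ≤ I) :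
    ∫ z in Set.Icc a b ×ℂ Set.Icc c d, g z ≤ (b - a) * I := by
  have hmp := Complex.volume_preserving_equiv_real_prod.symm
  have himg : ∀ p : ℝ × ℝ, Complex.measurableEquivRealProd.symm p = p.1 + p.2 * Complex.I :=
    fun p => by
      apply Complex.ext <;> simp [Complex.measurableEquivRealProd]
  have hpre : Complex.measurableEquivRealProd.symm ⁻¹' (Set.Icc a b ×ℂ Set.Icc c d) =
      Set.Icc a b ×ˢ Set.Icc c d := by
    ext p
    rw [Set.mem_preimage, himg, Complex.mem_reProdIm, Set.mem_prod]
    simp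
  have h1 := hmp.setIntegral_preimage_emb
    Complex.measurableEquivRealProd.symm.measurableEmbedding g (Set.Icc a b ×ℂ Set.Icc c d)
  rw [hpre] at h1
  simp only [himg] at h1
  have hc : ContinuousOn (fun p : ℝ × ℝ => g (p.1 + p.2 * Complex.I))
      (Set.Icc a b ×ˢ Set.Icc c d) := by
    refine hg.comp (by fun_prop) ?_
    rintro ⟨s, t⟩ ⟨h, h'⟩
    rw [Complex.mem_reProdIm]
    simpa using ⟨h, h'⟩
  have hintegral := hc.integrableOn_compact (μ := volume) (isCompact_Icc.prod isCompact_Icc)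
  rw [← h1, Measure.volume_eq_prod, setIntegral_prod _ (by rwa [← Measure.volume_eq_prod])]
  have h2 : ∫ x in Set.Icc a b, ∫ y in Set.Icc c d, g (x + y * Complex.I) ≤
      ∫ x in Set.Icc a b, I := by
    refine setIntegral_mono_on ?_ (by simp) measurableSet_Icc fun σ hσ => ?_
    · have := hintegral
      rw [Measure.volume_eq_prod, IntegrableOn, ← Measure.prod_restrict] at this
      exact this.integral_prod_left
    · rw [integral_Icc_eq_integral_Ioc, ← intervalIntegral.integral_of_le hcd]
      exact hI σ hσ
  refine h2.trans_eq ?_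
  simp [hab]

theorem sum_norm_rpow_le {f : ℂ → ℂ} {F : Finset ℂ} {a b c d r p I : ℝ} {B : ℕ}
    (hab : a ≤ b) (hcd : c ≤ d) (hr : 0 < r) (hp : 1 ≤ p)
    (hf : DifferentiableOn ℂ f (Set.Icc a b ×ℂ Set.Icc c d))
    (hF : ∀ ρ ∈ F, closedBall ρ r ⊆ Set.Icc a b ×ℂ Set.Icc c d)
    (hB : ∀ z : ℂ, (F.filter fun ρ => dist z ρ < r).card ≤ B)
    (hI : ∀ σ ∈ Set.Icc a b, ∫ t in c..d, ‖f (σ + t * Complex.I)‖ ^ p ≤ I) :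
    ∑ ρ ∈ F, ‖f ρ‖ ^ p ≤ (Real.pi * r ^ 2)⁻¹ * (B * ((b - a) * I)) := by
  set D := Set.Icc a b ×ℂ Set.Icc c d with hD
  have hDc : IsCompact D := isCompact_Icc.reProdIm isCompact_Icc
  have hcp : ContinuousOn (fun z => ‖f z‖ ^ p) D :=
    hf.continuousOn.norm.rpow_const fun _ _ => Or.inr (by linarith)
  have hiD : IntegrableOn (fun z => ‖f z‖ ^ p) D := hcp.integrableOn_compact hDc
  have hind : ∀ ρ ∈ F, ∫ z in ball ρ r, ‖f z‖ ^ p =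
      ∫ z in D, (ball ρ r).indicator (fun z => ‖f z‖ ^ p) z := fun ρ hρ => by
    rw [setIntegral_indicator measurableSet_ball,
      Set.inter_eq_right.2 (ball_subset_closedBall.trans (hF ρ hρ))]
  have hsum : ∀ z, ∑ ρ ∈ F, (ball ρ r).indicator (fun z => ‖f z‖ ^ p) z =
      (F.filter fun ρ => dist z ρ < r).card * ‖f z‖ ^ p := fun z => by
    simp only [Set.indicator, mem_ball]
    rw [← Finset.sum_filter, Finset.sum_const, nsmul_eq_mul]
  have hiI : ∀ ρ ∈ F, Integrable (fun z => (ball ρ r).indicator (fun z => ‖f z‖ ^ p) z)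
      (volume.restrict D) := fun ρ _ => hiD.indicator measurableSet_ball
  calc ∑ ρ ∈ F, ‖f ρ‖ ^ p
      ≤ ∑ ρ ∈ F, (Real.pi * r ^ 2)⁻¹ * ∫ z in ball ρ r, ‖f z‖ ^ p :=
        Finset.sum_le_sum fun ρ hρ => norm_rpow_le_setIntegral_ball hr hp (hf.mono (hF ρ hρ))
    _ = (Real.pi * r ^ 2)⁻¹ * ∫ z in D, ∑ ρ ∈ F, (ball ρ r).indicator (fun z => ‖f z‖ ^ p) z := by
        rw [← Finset.mul_sum, Finset.sum_congr rfl hind, integral_finsetSum F hiI]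
    _ ≤ (Real.pi * r ^ 2)⁻¹ * ∫ z in D, B * ‖f z‖ ^ p := by
        gcongr ?_ * ?_
        refine integral_mono (integrable_finsetSum F hiI) (hiD.const_mul _) fun z => ?_
        simp only [hsum]
        gcongr
        exact hB z
    _ ≤ _ := by
        rw [integral_const_mul]
        gcongr
        exact setIntegral_reProdIm_le hab hcd hcp hI

end

section

open Metric MeromorphicOn

theorem card_zeros_le {f : ℂ → ℂ} {c : ℂ} {r R M : ℝ} {F : Finset ℂ} (hr : 0 < r) (hrR : r < R)
    (hM : 1 ≤ M) (hf : AnalyticOnNhd ℂ f (closedBall c R)) (hc : f c ≠ 0)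
    (hb : ∀ z ∈ sphere c R, ‖f z‖ ≤ M) (hF : ∀ ρ ∈ F, ρ ∈ closedBall c r ∧ f ρ = 0) :
    (F.card : ℝ) ≤ Real.log (M / ‖f c‖) / Real.log (R / r) := by
  have hR : 0 < R := hr.trans hrR
  have hfr : AnalyticOnNhd ℂ f (closedBall c r) := hf.mono (closedBall_subset_closedBall hrR.le)
  have key := AnalyticOnNhd.sum_divisor_le (r := r) (R := R) (by rwa [abs_of_pos hr])
    (by rwa [abs_of_pos hr, abs_of_pos hR]) hM (by rwa [abs_of_pos hR]) hc
    (by rwa [abs_of_pos hR])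
  rw [abs_of_pos hr] at key
  refine le_trans ?_ key
  have hfin := (divisor f (closedBall c r)).finiteSupport (isCompact_closedBall c r)
  have hcc : c ∈ closedBall c r := mem_closedBall_self hr.le
  have h1 : ∀ ρ ∈ F, 1 ≤ divisor f (closedBall c r) ρ := fun ρ hρ => by
    obtain ⟨hmem, hz⟩ := hF ρ hρ
    rw [hfr.divisor_apply hmem]
    have h0 : analyticOrderAt f ρ ≠ 0 := (hfr ρ hmem).analyticOrderAt_ne_zero.2 hz
    have htop : analyticOrderAt f ρ ≠ ⊤ :=
      hfr.analyticOrderAt_ne_top_of_isPreconnected (convex_closedBall c r).isPreconnected hcc hmem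
        (by simp [(hfr c hcc).analyticOrderAt_eq_zero.2 hc])
    lift analyticOrderAt f ρ to ℕ using htop with k
    have : (k : ℤ) ≠ 0 := by exact_mod_cast h0
    change 1 ≤ (k : ℤ)
    lia
  rw [finsum_eq_sum_of_support_subset (s := hfin.toFinset) _ (by simp)]
  have h2 : (F.card : ℤ) ≤ ∑ ρ ∈ hfin.toFinset, divisor f (closedBall c r) ρ :=
    calc (F.card : ℤ) = ∑ ρ ∈ F, 1 := by simp
      _ ≤ ∑ ρ ∈ F, divisor f (closedBall c r) ρ := Finset.sum_le_sum h1
      _ ≤ _ := by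
        refine Finset.sum_le_sum_of_subset_of_nonneg (fun ρ hρ => ?_) fun ρ _ _ =>
          hfr.divisor_nonneg ρ
        have := h1 ρ hρ
        simp only [Set.Finite.mem_toFinset, Function.mem_support]
        lia
  exact_mod_cast h2

end

section

open MeasureTheory Set Asymptotics Filter Topology FourierTransform

/-- The Mellin transform at `-s` of the restriction of `e` to `(x, ∞)`. -/
noncomputable def tailMellin (e : ℝ → ℝ) (x : ℝ) (s : ℂ) : ℂ :=
  mellin ((Ioi x).indicator fun u => (e u : ℂ)) (-s)

section tailMellin

variable {e : ℝ → ℝ} {C θ x : ℝ}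

lemma tailMellin_eq (hx : 0 ≤ x) (s : ℂ) :
    tailMellin e x s = ∫ u in Ioi x, (u : ℂ) ^ (-s - 1) * (e u : ℂ) := by
  have h : ∀ u : ℝ, (u : ℂ) ^ (-s - 1) • (Ioi x).indicator (fun u => (e u : ℂ)) u =
      (Ioi x).indicator (fun u : ℝ => (u : ℂ) ^ (-s - 1) * (e u : ℂ)) u := fun u => by
    by_cases hu : u ∈ Ioi x <;> simp [hu]
  simp only [tailMellin, mellin, h]
  rw [setIntegral_indicator measurableSet_Ioi, Ioi_inter_Ioi, max_eq_right hx]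

lemma integrableOn_tailMellin (hm : Measurable e) (hx : 1 ≤ x)
    (he : ∀ u, 1 ≤ u → |e u| ≤ C * u ^ θ) {s : ℂ} (hs : θ < s.re) :
    IntegrableOn (fun u : ℝ => (u : ℂ) ^ (-s - 1) * (e u : ℂ)) (Ioi x) ∧
      ∀ u ∈ Ioi x, ‖(u : ℂ) ^ (-s - 1) * (e u : ℂ)‖ ≤ C * u ^ (θ - s.re - 1) := by
  have hx0 : 0 < x := by linarith
  have hb : ∀ u ∈ Ioi x, ‖(u : ℂ) ^ (-s - 1) * (e u : ℂ)‖ ≤ C * u ^ (θ - s.re - 1) := by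
    intro u hu
    have hu0 : 0 < u := hx0.trans hu
    rw [norm_mul, Complex.norm_cpow_eq_rpow_re_of_pos hu0, Complex.norm_real, Real.norm_eq_abs]
    calc u ^ (-s - 1 : ℂ).re * |e u| ≤ u ^ (-s - 1 : ℂ).re * (C * u ^ θ) := by
          gcongr
          exact he u (hx.trans (le_of_lt hu))
      _ = C * (u ^ (-s - 1 : ℂ).re * u ^ θ) := by ring
      _ = _ := by
          rw [← Real.rpow_add hu0]
          congr 2
          simp
          ring
  refine ⟨Integrable.mono' (((integrableOn_Ioi_rpow_of_lt (by linarith) hx0)).const_mul C) ?_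
    ((ae_restrict_iff' measurableSet_Ioi).2 (.of_forall hb)), hb⟩
  refine AEStronglyMeasurable.mul ?_ (Complex.measurable_ofReal.comp hm).aestronglyMeasurable
  refine (ContinuousOn.aestronglyMeasurable (fun u hu => ?_) measurableSet_Ioi)
  refine ContinuousAt.continuousWithinAt ?_
  exact (Complex.continuousAt_ofReal_cpow_const u _ (Or.inr (hx0.trans hu).ne'))

lemma norm_tailMellin_le (hm : Measurable e) (hx : 1 ≤ x)
    (he : ∀ u, 1 ≤ u → |e u| ≤ C * u ^ θ) {s : ℂ} (hs : θ < s.re) :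
    ‖tailMellin e x s‖ ≤ C * (x ^ (θ - s.re) / (s.re - θ)) := by
  have hx0 : 0 < x := by linarith
  obtain ⟨-, hb⟩ := integrableOn_tailMellin hm hx he hs
  rw [tailMellin_eq hx0.le]
  refine (norm_integral_le_of_norm_le
    ((integrableOn_Ioi_rpow_of_lt (by linarith) hx0).const_mul C)
    ((ae_restrict_iff' measurableSet_Ioi).2 (.of_forall hb))).trans_eq ?_
  rw [integral_const_mul, integral_Ioi_rpow_of_lt (by linarith) hx0]
  congr 1
  rw [show θ - s.re - 1 + 1 = θ - s.re by ring, ← neg_sub s.re θ, neg_div_neg_eq]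

lemma locallyIntegrableOn_indicator (hm : Measurable e) (hx : 1 ≤ x)
    (he : ∀ u, 1 ≤ u → |e u| ≤ C * u ^ θ) :
    LocallyIntegrableOn ((Ioi x).indicator fun u => (e u : ℂ)) (Ioi 0) := by
  have hx0 : 0 < x := by linarith
  have hmeas : AEStronglyMeasurable ((Ioi x).indicator fun u => (e u : ℂ)) :=
    ((Complex.measurable_ofReal.comp hm).indicator measurableSet_Ioi).aestronglyMeasurable
  have hg : LocallyIntegrableOn (fun u : ℝ => C * u ^ θ) (Ioi 0) := by
    refine ContinuousOn.locallyIntegrableOn (fun u hu => ?_) measurableSet_Ioi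
    exact ((Real.continuousAt_rpow_const u θ (Or.inl (ne_of_gt hu))).const_mul C).continuousWithinAt
  refine hg.mono hmeas (.of_forall fun u => ?_)
  by_cases hux : u ∈ Ioi x
  · rw [indicator_of_mem hux, Complex.norm_real]
    exact (he u (hx.trans (le_of_lt hux))).trans (le_abs_self _)
  · rw [indicator_of_notMem hux, norm_zero]
    exact norm_nonneg _

lemma differentiableAt_tailMellin (hm : Measurable e) (hx : 1 ≤ x)
    (he : ∀ u, 1 ≤ u → |e u| ≤ C * u ^ θ) {s : ℂ} (hs : θ < s.re) :
    DifferentiableAt ℂ (tailMellin e x) s := by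
  have hx0 : 0 < x := by linarith
  have h := mellin_differentiableAt_of_isBigO_rpow (f := (Ioi x).indicator fun u => (e u : ℂ))
    (s := -s) (a := -θ) (b := -s.re - 1) (locallyIntegrableOn_indicator hm hx he) ?_ (by simpa) ?_
    (by simp)
  · exact h.comp s differentiableAt_id.neg
  · rw [neg_neg]
    refine IsBigO.of_bound C ?_
    filter_upwards [eventually_gt_atTop x] with u hu
    rw [indicator_of_mem (show u ∈ Ioi x from hu), Complex.norm_real,
      Real.norm_of_nonneg (Real.rpow_nonneg (hx0.trans hu).le _)]
    exact he u (hx.trans hu.le)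
  · refine IsBigO.of_bound 0 ?_
    filter_upwards [mem_nhdsWithin_of_mem_nhds (Iio_mem_nhds hx0)] with u hu
    rw [indicator_of_notMem (by simpa using le_of_lt hu)]
    simp

lemma integral_norm_sq_tailMellin_le (hm : Measurable e) (hx : 1 ≤ x)
    (he : ∀ u, 1 ≤ u → |e u| ≤ C * u ^ θ) {σ : ℝ} (hσ : θ < σ) :
    Integrable (fun t : ℝ => ‖tailMellin e x (σ + t * Complex.I)‖ ^ 2) ∧
    ∫ t : ℝ, ‖tailMellin e x (σ + t * Complex.I)‖ ^ 2 ≤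
      2 * Real.pi * (C ^ 2 * (x ^ (2 * (θ - σ)) / (2 * (σ - θ)))) := by
  have hx0 : 0 < x := by linarith
  set f : ℝ → ℂ := (Ioi x).indicator fun u => (e u : ℂ) with hf
  set g : ℝ → ℂ := fun u => Real.exp (σ * u) • f (Real.exp (-u)) with hg
  have hgm : Measurable g := by
    have : Measurable f := (Complex.measurable_ofReal.comp hm).indicator measurableSet_Ioi
    fun_prop
  set b : ℝ → ℝ := (Iic (-Real.log x)).indicator fun u => C * Real.exp ((σ - θ) * u) with hbdef
  have hgb : ∀ u, ‖g u‖ ≤ b u := by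
    intro u
    by_cases hu : x < Real.exp (-u)
    · have hu' : u ≤ -Real.log x := by
        have := (Real.log_lt_iff_lt_exp hx0).2 hu
        linarith
      have := he _ (hx.trans hu.le)
      rw [hbdef, indicator_of_mem (show u ∈ Iic _ from hu'), hg]
      simp only [hf, indicator_of_mem (show Real.exp (-u) ∈ Ioi x from hu)]
      rw [norm_smul, Real.norm_of_nonneg (Real.exp_pos _).le, Complex.norm_real, Real.norm_eq_abs]
      calc _ ≤ Real.exp (σ * u) * (C * Real.exp (-u) ^ θ) := by gcongr
        _ = C * (Real.exp (σ * u) * Real.exp (-u) ^ θ) := by ring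
        _ = _ := by
          rw [← Real.exp_mul, ← Real.exp_add]
          ring_nf
    · have : f (Real.exp (-u)) = 0 := indicator_of_notMem hu _
      simp only [hg, this, smul_zero, norm_zero, hbdef, indicator]
      split_ifs
      · have := (abs_nonneg _).trans (he 1 le_rfl)
        rw [Real.one_rpow, mul_one] at this
        positivity
      · rfl
  have hpos : 0 < σ - θ := by linarith
  have hbi : Integrable b :=
    IntegrableOn.integrable_indicator ((integrableOn_exp_mul_Iic hpos _).const_mul C)
      measurableSet_Iic
  have hb2 : (fun u => b u ^ 2) = (Iic (-Real.log x)).indicator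
      fun u => C ^ 2 * Real.exp ((2 * (σ - θ)) * u) := by
    ext u
    simp only [hbdef, indicator]
    split_ifs
    · rw [mul_pow, ← Real.exp_nat_mul]
      push_cast
      ring_nf
    · simp
  have hbi2 : Integrable fun u => b u ^ 2 := by
    rw [hb2]
    exact IntegrableOn.integrable_indicator
      ((integrableOn_exp_mul_Iic (by positivity) _).const_mul _) measurableSet_Iic
  have hg1 : Integrable g := hbi.mono' hgm.aestronglyMeasurable (.of_forall hgb)
  have hgb2 : ∀ u, ‖g u‖ ^ 2 ≤ b u ^ 2 := fun u => by
    have := hgb u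
    gcongr
  have hgi2 : Integrable fun u => ‖g u‖ ^ 2 := by
    refine hbi2.mono' (hgm.norm.pow_const 2).aestronglyMeasurable (.of_forall fun u => ?_)
    rw [Real.norm_of_nonneg (by positivity)]
    exact hgb2 u
  have hg2 : MemLp g 2 := (memLp_two_iff_integrable_sq_norm hgm.aestronglyMeasurable).2 hgi2
  obtain ⟨hFi, hF⟩ := integral_norm_sq_fourier_eq hg1 hg2
  have hmf : ∀ t : ℝ, tailMellin e x (σ + t * Complex.I) = 𝓕 g ((-(2 * Real.pi)⁻¹) * t) := by
    intro t
    rw [tailMellin, mellin_eq_fourier]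
    have h1 : (-(σ + t * Complex.I) : ℂ).re = -σ := by simp
    have h2 : (-(σ + t * Complex.I) : ℂ).im = -t := by simp
    rw [h1, h2, neg_neg]
    have h3 : -t / (2 * Real.pi) = -(2 * Real.pi)⁻¹ * t := by ring
    rw [h3]
  have hne : (-(2 * Real.pi)⁻¹) ≠ 0 := by
    have := Real.pi_pos
    exact neg_ne_zero.2 (by positivity)
  simp only [hmf]
  refine ⟨hFi.comp_mul_left' hne, ?_⟩
  rw [Measure.integral_comp_mul_left (fun u => ‖𝓕 g u‖ ^ 2), hF, smul_eq_mul]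
  have habs : |(-(2 * Real.pi)⁻¹)⁻¹| = 2 * Real.pi := by
    rw [inv_neg, inv_inv, abs_neg, abs_of_pos (by positivity)]
  rw [habs]
  gcongr
  calc ∫ u, ‖g u‖ ^ 2 ≤ ∫ u, b u ^ 2 := integral_mono hgi2 hbi2 hgb2
    _ = _ := by
      rw [hb2, integral_indicator measurableSet_Iic, integral_const_mul,
        integral_exp_mul_Iic (by linarith), Real.rpow_def_of_pos hx0]
      ring_nf

end tailMellin

end

section

open MeasureTheory Set Asymptotics Filter Topology

namespace BeurlingSystem

/-- The integer counting function satisfies `|N(u) - A u| ≤ C u ^ θ` for all `u ≥ 1`. -/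
structure WellBehaved (S : BeurlingSystem) (θ A C : ℝ) : Prop where
  nonneg : 0 ≤ θ
  lt_one : θ < 1
  density_pos : 0 < A
  const_pos : 0 < C
  finite : ∀ x, {j | S.n j ≤ x}.Finite
  abs_sub_le : ∀ u : ℝ, 1 ≤ u → |(S.Nint u : ℝ) - A * u| ≤ C * u ^ θ

open Classical in
/-- The exponent vectors of the generalized integers up to `x`. -/
noncomputable def upTo (S : BeurlingSystem) (x : ℝ) : Finset (ℕ →₀ ℕ) :=
  if h : {k | S.weight k ≤ x}.Finite then h.toFinset else ∅

/-- The error term of the integer counting function. -/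
noncomputable def err (S : BeurlingSystem) (A u : ℝ) : ℝ := S.Nint u - A * u

variable {S : BeurlingSystem} {θ A C : ℝ}

lemma WellBehaved.mem_upTo (hS : S.WellBehaved θ A C) {x : ℝ} {k : ℕ →₀ ℕ} :
    k ∈ S.upTo x ↔ S.weight k ≤ x := by
  rw [upTo, dif_pos (S.finite_setOf_weight_le hS.finite x)]
  simp

lemma WellBehaved.card_upTo (hS : S.WellBehaved θ A C) (x : ℝ) : (S.upTo x).card = S.Nint x := by
  rw [Nint_eq_ncard, ← Set.ncard_coe_finset]
  congr 1
  ext k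
  simpa using hS.mem_upTo

lemma WellBehaved.measurable_Nint (hS : S.WellBehaved θ A C) :
    Measurable fun u => (S.Nint u : ℝ) :=
  Monotone.measurable fun _ _ h => Nat.cast_le.2 (Nint_mono hS.finite h)

lemma WellBehaved.measurable_err (hS : S.WellBehaved θ A C) : Measurable (S.err A) :=
  hS.measurable_Nint.sub (measurable_const.mul measurable_id)

lemma WellBehaved.abs_err_le (hS : S.WellBehaved θ A C) {u : ℝ} (hu : 1 ≤ u) :
    |S.err A u| ≤ C * u ^ θ := hS.abs_sub_le u hu

lemma WellBehaved.summable (hS : S.WellBehaved θ A C) {σ : ℝ} (hσ : 1 < σ) :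
    Summable fun k => S.weight k ^ (-σ) := by
  obtain ⟨D, hD, h⟩ := exists_Nint_le hS.lt_one hS.density_pos hS.const_pos hS.abs_sub_le
  exact summable_weight_rpow hS.finite hD h hσ

lemma integral_Ioi_indicator_cpow {w x : ℝ} (hx : 0 < x) {s : ℂ} (hs : 0 < s.re) :
    ∫ u in Ioi x, (Ici w).indicator (fun u : ℝ => (u : ℂ) ^ (-s - 1)) u =
      (max w x : ℝ) ^ (-s) / s := by
  have h : ∫ u in Ioi x, (Ici w).indicator (fun u : ℝ => (u : ℂ) ^ (-s - 1)) u =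
      ∫ u in Ioi (max w x), (u : ℂ) ^ (-s - 1) := by
    rw [setIntegral_indicator measurableSet_Ici, ← Ioi_inter_Ioi, inter_comm]
    refine setIntegral_congr_set (Ioi_ae_eq_Ici.symm.inter (ae_eq_refl _))
  have hs0 : s ≠ 0 := fun h => by simp [h] at hs
  rw [h, integral_Ioi_cpow_of_lt (by simp; linarith) (lt_max_of_lt_right hx), sub_add_cancel,
    neg_div_neg_eq]

/-- Partial summation for the zeta function of a well-behaved system. -/
theorem WellBehaved.tsum_cpow_eq (hS : S.WellBehaved θ A C) {s : ℂ} (hs : 1 < s.re) {x : ℝ}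
    (hx : 1 ≤ x) :
    ∑' k, (S.weight k : ℂ) ^ (-s) = ∑ k ∈ S.upTo x, (S.weight k : ℂ) ^ (-s) +
      A * (x : ℂ) ^ (1 - s) / (s - 1) - S.err A x * (x : ℂ) ^ (-s) +
        s * tailMellin (S.err A) x s := by
  have hx0 : 0 < x := by linarith
  have hsr : 0 < s.re := by linarith
  have hs0 : s ≠ 0 := fun h => by simp [h] at hsr
  have hs1 : s - 1 ≠ 0 := fun h => by
    rw [sub_eq_zero.1 h] at hs
    simp at hs
  have hsum : Summable fun k => (S.weight k : ℂ) ^ (-s) := by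
    refine Summable.of_norm ?_
    simpa only [norm_weight_cpow] using hS.summable hs
  have hcpow : IntegrableOn (fun u : ℝ => (u : ℂ) ^ (-s - 1)) (Ioi x) :=
    integrableOn_Ioi_cpow_of_lt (by simp; linarith) hx0
  -- the sum with `S.weight k` replaced by the maximum with `x`
  have hmax : ∑' k, ((max (S.weight k) x : ℝ) : ℂ) ^ (-s) =
      ∑' k, (S.weight k : ℂ) ^ (-s) - ∑ k ∈ S.upTo x, (S.weight k : ℂ) ^ (-s) +
        S.Nint x * (x : ℂ) ^ (-s) := by
    have hd : ∀ k ∉ S.upTo x,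
        ((max (S.weight k) x : ℝ) : ℂ) ^ (-s) - (S.weight k : ℂ) ^ (-s) = 0 := fun k hk => by
      rw [hS.mem_upTo, not_le] at hk
      rw [max_eq_left hk.le, sub_self]
    have hd' := hasSum_sum_of_ne_finset_zero (L := SummationFilter.unconditional _) hd
    have h1 := (hsum.hasSum.add hd').tsum_eq
    simp only [add_sub_cancel] at h1
    rw [h1, Finset.sum_sub_distrib, ← hS.card_upTo x]
    have h2 : ∑ k ∈ S.upTo x, ((max (S.weight k) x : ℝ) : ℂ) ^ (-s) =
        (S.upTo x).card * (x : ℂ) ^ (-s) := by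
      rw [Finset.sum_congr rfl fun k hk => by rw [max_eq_right (hS.mem_upTo.1 hk)],
        Finset.sum_const, nsmul_eq_mul]
    rw [h2]
    ring
  have hswap : HasSum (fun k => ((max (S.weight k) x : ℝ) : ℂ) ^ (-s) / s)
      (∫ u in Ioi x, ∑' k, (Ici (S.weight k)).indicator (fun u : ℝ => (u : ℂ) ^ (-s - 1)) u) := by
    have := hasSum_integral_of_summable_integral_norm (μ := volume.restrict (Ioi x))
      (F := fun k => (Ici (S.weight k)).indicator fun u : ℝ => (u : ℂ) ^ (-s - 1))
      (fun k => hcpow.indicator measurableSet_Ici) ?_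
    · simpa only [integral_Ioi_indicator_cpow hx0 hsr] using this
    · have hnorm : ∀ k, ∫ u in Ioi x, ‖(Ici (S.weight k)).indicator
          (fun u : ℝ => (u : ℂ) ^ (-s - 1)) u‖ = max (S.weight k) x ^ (-s.re) / s.re := by
        intro k
        have h1 : ∫ u in Ioi x, ‖(Ici (S.weight k)).indicator
          (fun u : ℝ => (u : ℂ) ^ (-s - 1)) u‖ = ∫ u in Ioi x, (Ici (S.weight k)).indicator
          (fun u : ℝ => u ^ (-s.re - 1)) u := by
          refine setIntegral_congr_fun measurableSet_Ioi fun u hu => ?_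
          simp only [indicator]
          split_ifs
          · rw [Complex.norm_cpow_eq_rpow_re_of_pos (hx0.trans hu)]
            simp
          · exact norm_zero
        have h2 : ∫ u in Ioi x, (Ici (S.weight k)).indicator (fun u : ℝ => u ^ (-s.re - 1)) u =
            ∫ u in Ioi (max (S.weight k) x), u ^ (-s.re - 1) := by
          rw [setIntegral_indicator measurableSet_Ici, ← Ioi_inter_Ioi, inter_comm]
          exact setIntegral_congr_set (Ioi_ae_eq_Ici.symm.inter (ae_eq_refl _))
        rw [h1, h2, integral_Ioi_rpow_of_lt (by linarith) (lt_max_of_lt_right hx0),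
          sub_add_cancel, neg_div_neg_eq]
      simp only [hnorm]
      refine Summable.div_const (Summable.of_nonneg_of_le (fun k => by positivity) (fun k => ?_)
        (hS.summable hs)) _
      exact Real.rpow_le_rpow_of_nonpos (S.weight_pos k) (le_max_left _ _) (by linarith)
  have hpt : ∀ u : ℝ, ∑' k, (Ici (S.weight k)).indicator (fun u : ℝ => (u : ℂ) ^ (-s - 1)) u =
      S.Nint u * (u : ℂ) ^ (-s - 1) := fun u => by
    rw [tsum_eq_sum (s := S.upTo u), ← hS.card_upTo, ← nsmul_eq_mul, ← Finset.sum_const]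
    · refine Finset.sum_congr rfl fun k hk => ?_
      rw [indicator_of_mem (show u ∈ Ici (S.weight k) from hS.mem_upTo.1 hk)]
    · intro k hk
      exact indicator_of_notMem (fun h => hk (hS.mem_upTo.2 h)) _
  have hN : ∑' k, ((max (S.weight k) x : ℝ) : ℂ) ^ (-s) =
      s * ∫ u in Ioi x, S.Nint u * (u : ℂ) ^ (-s - 1) := by
    have := hswap.tsum_eq
    simp only [hpt] at this
    rw [← this, tsum_div_const, mul_div_cancel₀ _ hs0]
  have hintegral : ∫ u in Ioi x, S.Nint u * (u : ℂ) ^ (-s - 1) =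
      A * ((x : ℂ) ^ (1 - s) / (s - 1)) + tailMellin (S.err A) x s := by
    have hA1 : ∫ u in Ioi x, (A : ℂ) * (u : ℂ) ^ (-s) = A * ((x : ℂ) ^ (1 - s) / (s - 1)) := by
      rw [integral_const_mul, integral_Ioi_cpow_of_lt (by simpa using hs) hx0,
        show -s + 1 = 1 - s by ring, ← neg_sub s 1, neg_div_neg_eq]
    rw [← hA1, tailMellin_eq hx0.le, ← integral_add]
    · refine setIntegral_congr_fun measurableSet_Ioi fun u hu => ?_
      have hu0 : (u : ℂ) ≠ 0 := Complex.ofReal_ne_zero.2 (hx0.trans hu).ne'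
      have : (u : ℂ) ^ (-s) = (u : ℂ) ^ (-s - 1) * u := by
        nth_rw 3 [← Complex.cpow_one (u : ℂ)]
        rw [← Complex.cpow_add _ _ hu0, sub_add_cancel]
      simp only [err]
      rw [this]
      push_cast
      ring
    · exact (integrableOn_Ioi_cpow_of_lt (by simpa using hs) hx0).const_mul _
    · exact (integrableOn_tailMellin hS.measurable_err hx (fun u hu => hS.abs_err_le hu)
        (hS.lt_one.trans hs)).1
  have hxx : (x : ℂ) ^ (1 - s) = (x : ℂ) ^ (-s) * x := by
    nth_rw 3 [← Complex.cpow_one (x : ℂ)]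
    rw [← Complex.cpow_add _ _ (Complex.ofReal_ne_zero.2 hx0.ne'), neg_add_eq_sub]
  have hfinal : ∑' k, (S.weight k : ℂ) ^ (-s) = ∑ k ∈ S.upTo x, (S.weight k : ℂ) ^ (-s) -
      S.Nint x * (x : ℂ) ^ (-s) + s * (A * ((x : ℂ) ^ (1 - s) / (s - 1)) +
        tailMellin (S.err A) x s) := by
    rw [← hintegral, ← hN, hmax]
    ring
  rw [hfinal, hxx]
  simp only [err]
  push_cast
  field_simp
  ring

end BeurlingSystem

end

section

open MeasureTheory Set Asymptotics Filter Topology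

namespace BeurlingSystem

/-- The analytic function equal to `(s - 1) Z s` away from `s = 1` and to `A` at `s = 1`. -/
noncomputable def zetaReg (A : ℝ) (Z : ℂ → ℂ) (s : ℂ) : ℂ := (s - 1) * (Z s - A / (s - 1)) + A

variable {S : BeurlingSystem} {θ A C : ℝ} {Z : ℂ → ℂ}

lemma zetaReg_of_ne {s : ℂ} (hs : s ≠ 1) : zetaReg A Z s = (s - 1) * Z s := by
  have := sub_ne_zero.2 hs
  rw [zetaReg, mul_sub, mul_div_cancel₀ _ this, sub_add_cancel]

lemma IsZeta.eq_tsum (hZ : S.IsZeta θ A Z) {s : ℂ} (hs : 1 < s.re) :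
    Z s = ∑' k, (S.weight k : ℂ) ^ (-s) := by
  rw [hZ.1 s hs, ← S.equiv.tsum_eq]
  rfl

lemma ne_one_of_one_lt_re {s : ℂ} (hs : 1 < s.re) : s ≠ 1 := fun h => by simp [h] at hs

lemma isOpen_re_gt (θ : ℝ) : IsOpen {s : ℂ | θ < s.re} := isOpen_lt continuous_const Complex.continuous_re

lemma IsZeta.differentiableOn_zetaReg (hZ : S.IsZeta θ A Z) :
    DifferentiableOn ℂ (zetaReg A Z) {s : ℂ | θ < s.re} :=
  ((differentiableOn_id.sub_const 1).mul hZ.2).add_const _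

theorem WellBehaved.zetaReg_eq (hS : S.WellBehaved θ A C) (hZ : S.IsZeta θ A Z) {x : ℝ}
    (hx : 1 ≤ x) {s : ℂ} (hs : θ < s.re) :
    zetaReg A Z s = (s - 1) * (∑ k ∈ S.upTo x, (S.weight k : ℂ) ^ (-s) -
      S.err A x * (x : ℂ) ^ (-s) + s * tailMellin (S.err A) x s) + A * (x : ℂ) ^ (1 - s) := by
  have hx0 : (x : ℂ) ≠ 0 := Complex.ofReal_ne_zero.2 (by linarith)
  have hd : DifferentiableOn ℂ (fun s : ℂ => (s - 1) * (∑ k ∈ S.upTo x, (S.weight k : ℂ) ^ (-s) -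
      S.err A x * (x : ℂ) ^ (-s) + s * tailMellin (S.err A) x s) + A * (x : ℂ) ^ (1 - s))
      {s : ℂ | θ < s.re} := by
    have ht : DifferentiableOn ℂ (tailMellin (S.err A) x) {s : ℂ | θ < s.re} := fun s hs =>
      (differentiableAt_tailMellin hS.measurable_err hx (fun u hu => hS.abs_err_le hu)
        hs).differentiableWithinAt
    have hp : ∀ w : ℂ, w ≠ 0 → Differentiable ℂ fun s : ℂ => w ^ (-s) := fun w hw =>
      (differentiable_id.neg).const_cpow (Or.inl hw)
    have hp' : Differentiable ℂ fun s : ℂ => (x : ℂ) ^ (1 - s) :=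
      (differentiable_id.const_sub 1).const_cpow (Or.inl hx0)
    refine DifferentiableOn.add (DifferentiableOn.mul (differentiableOn_id.sub_const 1) ?_)
      (hp'.differentiableOn.const_mul _)
    refine ((DifferentiableOn.fun_sum fun k _ => (hp _ ?_).differentiableOn).sub
      ((hp _ hx0).differentiableOn.const_mul _)).add (differentiableOn_id.mul ht)
    exact Complex.ofReal_ne_zero.2 (S.weight_pos k).ne'
  have hpre : IsPreconnected {s : ℂ | θ < s.re} := (convex_halfSpace_re_gt θ).isPreconnected
  refine (hZ.differentiableOn_zetaReg.analyticOnNhd (isOpen_re_gt θ)).eqOn_of_preconnected_of_eventuallyEq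
    (hd.analyticOnNhd (isOpen_re_gt θ)) hpre (z₀ := 2) ?_ ?_ hs
  · have := hS.lt_one
    simp only [mem_ofPred_eq, Complex.re_ofNat]
    linarith
  · filter_upwards [(isOpen_re_gt 1).mem_nhds (show (2 : ℂ) ∈ {s : ℂ | 1 < s.re} by simp)] with s hs
    have hs1 := ne_one_of_one_lt_re hs
    have hs1' := sub_ne_zero.2 hs1
    rw [zetaReg_of_ne hs1, hZ.eq_tsum hs, hS.tsum_cpow_eq hs hx]
    field_simp
    ring

theorem WellBehaved.exists_norm_zetaReg_le (hS : S.WellBehaved θ A C) (hZ : S.IsZeta θ A Z)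
    {δ : ℝ} (hδ : 0 < δ) :
    ∃ M > 0, ∀ s : ℂ, θ + δ ≤ s.re → ‖zetaReg A Z s‖ ≤ M * (1 + ‖s‖) ^ 2 := by
  have hC := hS.const_pos
  have hA := hS.density_pos
  refine ⟨S.Nint 1 + C + C / δ + A, by positivity, fun s hs => ?_⟩
  have hsθ : θ < s.re := by linarith
  have hsr : 0 ≤ s.re := by linarith [hS.nonneg]
  rw [hS.zetaReg_eq hZ le_rfl hsθ]
  have h1 : ‖∑ k ∈ S.upTo 1, (S.weight k : ℂ) ^ (-s)‖ ≤ S.Nint 1 := by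
    refine (norm_sum_le _ _).trans ?_
    refine (Finset.sum_le_card_nsmul _ _ 1 fun k _ => ?_).trans (by simp [hS.card_upTo])
    rw [norm_weight_cpow]
    exact Real.rpow_le_one_of_one_le_of_nonpos (S.one_le_weight k) (by linarith)
  have h2 : ‖(S.err A 1 : ℂ)‖ ≤ C := by
    have := hS.abs_err_le (le_refl 1)
    rw [Real.one_rpow, mul_one] at this
    rwa [Complex.norm_real]
  have h3 : ‖tailMellin (S.err A) 1 s‖ ≤ C / δ := by
    refine (norm_tailMellin_le hS.measurable_err le_rfl (fun u hu => hS.abs_err_le hu)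
      hsθ).trans ?_
    rw [Real.one_rpow, mul_one_div]
    gcongr
    linarith
  have hs0 := norm_nonneg s
  simp only [Complex.ofReal_one, Complex.one_cpow, mul_one]
  calc _ ≤ ‖s - 1‖ * (‖∑ k ∈ S.upTo 1, (S.weight k : ℂ) ^ (-s)‖ + ‖(S.err A 1 : ℂ)‖ +
        ‖s‖ * ‖tailMellin (S.err A) 1 s‖) + A := by
        refine (norm_add_le _ _).trans ?_
        rw [norm_mul, Complex.norm_real, Real.norm_of_nonneg hA.le]
        gcongr
        refine (norm_add_le _ _).trans ?_
        rw [norm_mul]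
        gcongr
        exact norm_sub_le _ _
    _ ≤ (1 + ‖s‖) * (S.Nint 1 + C + ‖s‖ * (C / δ)) + A := by
        gcongr
        refine (norm_sub_le _ _).trans ?_
        rw [norm_one, add_comm]
    _ ≤ _ := by
        have h4 : (0 : ℝ) ≤ S.Nint 1 := Nat.cast_nonneg _
        have h5 : 0 < C / δ := by positivity
        nlinarith [mul_nonneg h4 hs0, mul_nonneg hC.le hs0, mul_nonneg h5.le hs0,
          mul_nonneg hA.le hs0, mul_nonneg (mul_nonneg h4 hs0) hs0, mul_nonneg (mul_nonneg hC.le hs0) hs0,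
          mul_nonneg (mul_nonneg hA.le hs0) hs0]

lemma WellBehaved.ne_zero_of_one_lt_re (hS : S.WellBehaved θ A C) (hZ : S.IsZeta θ A Z) {s : ℂ}
    (hs : 1 < s.re) : Z s ≠ 0 := fun h => by
  have := one_le_norm_mul_tsum (fun σ hσ => hS.summable hσ) hs
  rw [← hZ.eq_tsum hs, h, norm_zero, zero_mul] at this
  linarith

theorem WellBehaved.exists_le_norm_zetaReg_two_add (hS : S.WellBehaved θ A C)
    (hZ : S.IsZeta θ A Z) : ∃ c > 0, ∀ t : ℝ, c ≤ ‖zetaReg A Z (2 + t * Complex.I)‖ := by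
  set W := ∑' k, S.weight k ^ (-2 : ℝ) with hW
  have hre : ∀ t : ℝ, (2 + t * Complex.I : ℂ).re = 2 := fun t => by simp
  have key : ∀ t : ℝ, 1 ≤ ‖Z (2 + t * Complex.I)‖ * W := fun t => by
    have hs : 1 < (2 + t * Complex.I : ℂ).re := by rw [hre]; norm_num
    have := one_le_norm_mul_tsum (fun σ hσ => hS.summable hσ) hs
    rwa [← hZ.eq_tsum hs, hre] at this
  have hW0 : 0 < W := by
    have := key 0
    by_contra hcon
    push Not at hcon
    have := mul_nonpos_of_nonneg_of_nonpos (norm_nonneg (Z (2 + (0 : ℝ) * Complex.I))) hcon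
    linarith
  refine ⟨W⁻¹, by positivity, fun t => ?_⟩
  have hs : 1 < (2 + t * Complex.I : ℂ).re := by rw [hre]; norm_num
  rw [zetaReg_of_ne (ne_one_of_one_lt_re hs), norm_mul]
  have h1 : 1 ≤ ‖(2 + t * Complex.I : ℂ) - 1‖ := by
    refine le_trans ?_ (Complex.abs_re_le_norm _)
    rw [Complex.sub_re, hre]
    norm_num
  have h2 : W⁻¹ ≤ ‖Z (2 + t * Complex.I)‖ := (inv_le_iff_one_le_mul₀ hW0).2 (key t)
  nlinarith [norm_nonneg (Z (2 + t * Complex.I))]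

/-- The number of zeros in a short window is logarithmic. -/
theorem WellBehaved.exists_card_zeros_window_le (hS : S.WellBehaved θ A C) (hZ : S.IsZeta θ A Z) :
    ∃ K > 0, ∀ (γ : ℝ) (F : Finset ℂ),
      (∀ ρ ∈ F, Z ρ = 0 ∧ (1 + θ) / 2 ≤ ρ.re ∧ |ρ.im - γ| ≤ (1 - θ) / 8) →
        (F.card : ℝ) ≤ K * Real.log (|γ| + 2) := by
  classical
  have hθ0 := hS.nonneg
  have hθ1 := hS.lt_one
  set L := 1 - θ with hL
  have hL0 : 0 < L := by linarith
  obtain ⟨M, hM0, hM⟩ := hS.exists_norm_zetaReg_le hZ (δ := L / 4) (by positivity)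
  obtain ⟨c, hc0, hc⟩ := hS.exists_le_norm_zetaReg_two_add hZ
  have hlog2 : 0 < Real.log 2 := Real.log_pos one_lt_two
  set r := 1 + L / 2 + L / 8 with hr
  set R := 1 + 3 * L / 4 with hR
  have hr0 : 0 < r := by positivity
  have hrR : r < R := by linarith
  set q := Real.log (R / r) with hq
  have hq0 : 0 < q := Real.log_pos ((one_lt_div hr0).2 hrR)
  refine ⟨1 / Real.log 2 + (|Real.log ((M + 1) / c)| / Real.log 2 + 6) / q, by positivity,
    fun γ F hF => ?_⟩
  set y := Real.log (|γ| + 2) with hy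
  have hy2 : Real.log 2 ≤ y := Real.log_le_log two_pos (by linarith [abs_nonneg γ])
  have hy0 : 0 < y := hlog2.trans_le hy2
  set z₀ : ℂ := 2 + γ * Complex.I with hz₀
  set B := (M + 1) * (5 + |γ|) ^ 2 with hB
  have hre : ∀ z : ℂ, |z.re - 2| ≤ ‖z - z₀‖ := fun z => by
    have := Complex.abs_re_le_norm (z - z₀)
    simpa [hz₀] using this
  have hball : ∀ z ∈ Metric.closedBall z₀ R, θ + L / 4 ≤ z.re := fun z hz => by
    rw [mem_closedBall_iff_norm] at hz
    have := (abs_le.1 ((hre z).trans hz)).1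
    linarith
  have hcard : ((F.erase 1).card : ℝ) ≤ Real.log (B / ‖zetaReg A Z z₀‖) / q := by
    refine card_zeros_le (f := zetaReg A Z) hr0 hrR ?_ ?_ ?_ ?_ ?_
    · rw [hB]
      nlinarith [abs_nonneg γ, mul_nonneg hM0.le (abs_nonneg γ)]
    · exact (hZ.differentiableOn_zetaReg.analyticOnNhd (isOpen_re_gt θ)).mono fun z hz => by
        have := hball z hz
        simp only [mem_ofPred_eq]
        linarith
    · exact norm_pos_iff.1 (hc0.trans_le (hc γ))
    · intro z hz
      have hz' := Metric.sphere_subset_closedBall hz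
      refine (hM z (hball z hz')).trans ?_
      rw [mem_closedBall_iff_norm] at hz'
      have h1 : ‖z₀‖ ≤ 2 + |γ| := by
        refine (norm_add_le _ _).trans ?_
        simp
      have h2 : ‖z‖ ≤ ‖z - z₀‖ + ‖z₀‖ := by simpa using norm_add_le (z - z₀) z₀
      have h3 : 1 + ‖z‖ ≤ 5 + |γ| := by linarith
      rw [hB]
      have : M ≤ M + 1 := by linarith
      gcongr
    · intro ρ hρ
      rw [Finset.mem_erase] at hρ
      obtain ⟨hz, hβ, hγ⟩ := hF ρ hρ.2
      refine ⟨?_, by rw [zetaReg_of_ne hρ.1, hz, mul_zero]⟩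
      have hβ1 : ρ.re ≤ 1 := by
        by_contra hcon
        exact hS.ne_zero_of_one_lt_re hZ (not_le.1 hcon) hz
      rw [mem_closedBall_iff_norm]
      refine (Complex.norm_le_abs_re_add_abs_im _).trans ?_
      have h1 : (ρ - z₀).re = ρ.re - 2 := by simp [hz₀]
      have h2 : (ρ - z₀).im = ρ.im - γ := by simp [hz₀]
      rw [h1, h2, hr]
      have : |ρ.re - 2| ≤ 1 + L / 2 := by
        rw [abs_le]
        constructor <;> linarith
      linarith
  have h5 : 0 < 5 + |γ| := by positivity
  have hlogB : Real.log (B / ‖zetaReg A Z z₀‖) ≤ Real.log ((M + 1) / c) + 6 * y := by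
    calc Real.log (B / ‖zetaReg A Z z₀‖) ≤ Real.log (B / c) := by
          refine Real.log_le_log (div_pos (by positivity) (hc0.trans_le (hc γ))) ?_
          gcongr
          exact hc γ
      _ = Real.log ((M + 1) / c) + 2 * Real.log (5 + |γ|) := by
          rw [hB, mul_div_right_comm, Real.log_mul (by positivity) (by positivity), Real.log_pow]
          norm_num
      _ ≤ _ := by
          have : Real.log (5 + |γ|) ≤ 3 * y := by
            have h3 : 3 * y = Real.log ((|γ| + 2) ^ 3) := by
              rw [Real.log_pow, ← hy]
              norm_num
            rw [h3]
            refine Real.log_le_log h5 ?_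
            nlinarith [abs_nonneg γ, sq_nonneg |γ|, mul_nonneg (abs_nonneg γ) (sq_nonneg |γ|)]
          linarith
  have hle : (F.card : ℝ) ≤ (F.erase 1).card + 1 := by
    have := Finset.pred_card_le_card_erase (s := F) (a := (1 : ℂ))
    exact_mod_cast (show F.card ≤ (F.erase 1).card + 1 by omega)
  have h6 : Real.log ((M + 1) / c) ≤ |Real.log ((M + 1) / c)| / Real.log 2 * y := by
    refine (le_abs_self _).trans ?_
    rw [div_mul_eq_mul_div, le_div_iff₀ hlog2]
    gcongr
  have h7 : 1 ≤ 1 / Real.log 2 * y := by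
    rw [one_div_mul_eq_div, one_le_div hlog2]
    exact hy2
  calc (F.card : ℝ) ≤ 1 + Real.log (B / ‖zetaReg A Z z₀‖) / q := by linarith
    _ ≤ 1 / Real.log 2 * y + (|Real.log ((M + 1) / c)| / Real.log 2 * y + 6 * y) / q := by
        gcongr
        linarith
    _ = _ := by ring

/-- The number of zeros up to height `H` is `O(H log H)`. -/
theorem WellBehaved.exists_card_zeros_le (hS : S.WellBehaved θ A C) (hZ : S.IsZeta θ A Z) :
    ∃ K > 0, ∀ (H : ℝ) (F : Finset ℂ), 1 ≤ H →
      (∀ ρ ∈ F, Z ρ = 0 ∧ (1 + θ) / 2 ≤ ρ.re ∧ |ρ.im| ≤ H) →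
        (F.card : ℝ) ≤ K * H * Real.log (H + 3) := by
  obtain ⟨K, hK0, hK⟩ := hS.exists_card_zeros_window_le hZ
  have hθ0 := hS.nonneg
  have hθ1 := hS.lt_one
  set h := (1 - θ) / 8 with hh
  have h0 : 0 < h := by rw [hh]; linarith
  refine ⟨(2 / h + 2) * K, by positivity, fun H F hH hF => ?_⟩
  have hlog : 0 < Real.log (H + 3) := Real.log_pos (by linarith)
  have hfl : ∀ ρ ∈ F, ⌊ρ.im / h⌋ ∈ Finset.Icc ⌊-H / h⌋ ⌊H / h⌋ := fun ρ hρ => by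
    have := abs_le.1 (hF ρ hρ).2.2
    rw [Finset.mem_Icc]
    constructor
    · exact Int.floor_mono (by gcongr; exact this.1)
    · exact Int.floor_mono (by gcongr; exact this.2)
  rw [Finset.card_eq_sum_card_fiberwise hfl]
  push_cast
  have hfib : ∀ n ∈ Finset.Icc ⌊-H / h⌋ ⌊H / h⌋,
      ((F.filter fun ρ => ⌊ρ.im / h⌋ = n).card : ℝ) ≤ K * Real.log (H + 3) := fun n hn => by
    refine (hK (h * n) _ fun ρ hρ => ?_).trans ?_
    · obtain ⟨hρF, rfl⟩ := Finset.mem_filter.1 hρ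
      refine ⟨(hF ρ hρF).1, (hF ρ hρF).2.1, ?_⟩
      have h1 := Int.floor_le (ρ.im / h)
      have h2 := (Int.lt_floor_add_one (ρ.im / h)).le
      rw [le_div_iff₀ h0] at h1
      rw [div_le_iff₀ h0] at h2
      rw [abs_le]
      constructor <;> linarith
    · refine mul_le_mul_of_nonneg_left (Real.log_le_log (by positivity) ?_) hK0.le
      rw [Finset.mem_Icc] at hn
      have h1 : (n : ℝ) ≤ H / h := Int.le_floor.1 hn.2
      have h2 : -H / h - 1 < n := (Int.sub_one_lt_floor _).trans_le (by exact_mod_cast hn.1)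
      have h3 : h * n ≤ H := by rwa [le_div_iff₀' h0] at h1
      have h4 : -H - h < h * n := by
        have := mul_lt_mul_of_pos_left h2 h0
        rwa [mul_sub, mul_div_cancel₀ _ h0.ne', mul_one] at this
      have h5 : |h * (n : ℝ)| ≤ H + h := by
        rw [abs_le]
        constructor <;> linarith
      have h6 : h ≤ 1 := by rw [hh]; linarith
      linarith
  refine (Finset.sum_le_card_nsmul _ _ _ hfib).trans ?_
  rw [nsmul_eq_mul, Int.card_Icc]
  have hcnt : (((⌊H / h⌋ + 1 - ⌊-H / h⌋).toNat : ℕ) : ℝ) ≤ (2 / h + 2) * H := by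
    have h1 : ⌊-H / h⌋ ≤ ⌊H / h⌋ := Int.floor_mono (by gcongr; linarith)
    have h2 : (((⌊H / h⌋ + 1 - ⌊-H / h⌋).toNat : ℕ) : ℝ) =
        ((⌊H / h⌋ + 1 - ⌊-H / h⌋ : ℤ) : ℝ) := by
      exact_mod_cast Int.toNat_of_nonneg (by linarith)
    rw [h2]
    push_cast
    have h3 := Int.floor_le (H / h)
    have h4 := Int.sub_one_lt_floor (-H / h)
    calc _ ≤ 2 * (H / h) + 2 := by rw [neg_div] at h4; rw [neg_div]; linarith
      _ ≤ 2 * (H / h) + 2 * H := by linarith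
      _ = _ := by ring
  calc _ ≤ (2 / h + 2) * H * (K * Real.log (H + 3)) := by gcongr
    _ = _ := by ring

end BeurlingSystem

end

section

open Finset.HasAntidiagonal

namespace BeurlingSystem

variable (S : BeurlingSystem)

/-- Evaluation at `s` of the Dirichlet polynomial encoded by a polynomial in the primes. -/
noncomputable def dirichletEval (s : ℂ) : MvPolynomial ℕ ℂ →+* ℂ :=
  MvPolynomial.eval fun j => (S.p j : ℂ) ^ (-s)

variable {S}

lemma prod_prime_cpow (S : BeurlingSystem) (d : ℕ →₀ ℕ) (s : ℂ) :
    ∏ j ∈ d.support, ((S.p j : ℂ) ^ s) ^ d j = (S.weight d : ℂ) ^ s := by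
  rw [weight_eq_prod, Finsupp.prod]
  induction d.support using Finset.induction_on with
  | empty => simp
  | insert j F hj ih =>
    have hp := fun j => (one_pos.trans (S.one_lt_prime j)).le
    rw [Finset.prod_insert hj, Finset.prod_insert hj, ih, Complex.ofReal_mul,
      Complex.mul_cpow_ofReal_nonneg (pow_nonneg (hp j) _)
        (Finset.prod_nonneg fun i _ => pow_nonneg (hp i) _)]
    congr 1
    rw [Complex.ofReal_pow, ← Complex.cpow_nat_mul]
    have harg := Complex.arg_ofReal_of_nonneg (hp j)
    exact Complex.cpow_nat_mul' (by simp [harg, Real.pi_pos]) (by simp [harg, Real.pi_pos.le]) s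

lemma dirichletEval_eq (f : MvPolynomial ℕ ℂ) (s : ℂ) : S.dirichletEval s f =
    ∑ d ∈ f.support, f.coeff d * (S.weight d : ℂ) ^ (-s) := by
  rw [dirichletEval, MvPolynomial.eval_eq]
  exact Finset.sum_congr rfl fun d _ => by rw [prod_prime_cpow]

lemma dirichletEval_monomial (d : ℕ →₀ ℕ) (c s : ℂ) :
    S.dirichletEval s (MvPolynomial.monomial d c) = c * (S.weight d : ℂ) ^ (-s) := by
  rw [dirichletEval, MvPolynomial.eval_monomial, Finsupp.prod, prod_prime_cpow]

lemma differentiable_dirichletEval (f : MvPolynomial ℕ ℂ) :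
    Differentiable ℂ fun s => S.dirichletEval s f := by
  simp only [dirichletEval_eq]
  refine Differentiable.fun_sum fun d _ => Differentiable.const_mul ?_ _
  exact (differentiable_id.neg).const_cpow
    (Or.inl (Complex.ofReal_ne_zero.2 (S.weight_pos d).ne'))

lemma coeff_pow_ne_zero {f : MvPolynomial ℕ ℂ} {L R : ℝ} (hL : 0 ≤ L)
    (hf : ∀ d, f.coeff d ≠ 0 → L ≤ S.weight d ∧ S.weight d ≤ R) (k : ℕ) :
    ∀ d, (f ^ k).coeff d ≠ 0 → L ^ k ≤ S.weight d ∧ S.weight d ≤ R ^ k := by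
  induction k with
  | zero =>
    intro d hd
    rw [pow_zero, MvPolynomial.coeff_one] at hd
    obtain rfl : 0 = d := by simpa using hd
    simp [weight_zero]
  | succ k ih =>
    intro d hd
    rw [pow_succ, MvPolynomial.coeff_mul] at hd
    obtain ⟨x, hx, hx0⟩ := Finset.exists_ne_zero_of_sum_ne_zero hd
    have h1 := ih x.1 (left_ne_zero_of_mul hx0)
    have h2 := hf x.2 (right_ne_zero_of_mul hx0)
    have hpos := S.weight_pos
    rw [← mem_antidiagonal.1 hx, weight_add, pow_succ, pow_succ]
    exact ⟨mul_le_mul h1.1 h2.1 hL (hpos _).le,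
      mul_le_mul h1.2 h2.2 (hpos _).le ((hpos _).le.trans h1.2)⟩

lemma norm_coeff_pow_le {f : MvPolynomial ℕ ℂ} {D η : ℝ} (hD : 1 ≤ D) (hη : 0 ≤ η)
    (hdiv : ∀ n, ((antidiagonal n).card : ℝ) ≤ D * S.weight n ^ η)
    (hf : ∀ d, ‖f.coeff d‖ ≤ D * S.weight d ^ η) (k : ℕ) (d : ℕ →₀ ℕ) :
    ‖(f ^ k).coeff d‖ ≤ D ^ (2 * k) * S.weight d ^ (2 * k * η) := by
  induction k generalizing d with
  | zero =>
    rw [pow_zero, MvPolynomial.coeff_one]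
    split_ifs <;> simp
  | succ k ih =>
    rw [pow_succ, MvPolynomial.coeff_mul]
    have hw := S.one_le_weight
    have hbd : ∀ x ∈ antidiagonal d, ‖(f ^ k).coeff x.1 * f.coeff x.2‖ ≤
        D ^ (2 * k) * S.weight d ^ (2 * k * η) * (D * S.weight d ^ η) := fun x hx => by
      have hx := mem_antidiagonal.1 hx
      have h1 : S.weight x.1 ≤ S.weight d := by
        rw [← hx, weight_add]
        exact le_mul_of_one_le_right (S.weight_pos _).le (hw _)
      have h2 : S.weight x.2 ≤ S.weight d := by
        rw [← hx, weight_add]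
        exact le_mul_of_one_le_left (S.weight_pos _).le (hw _)
      have p1 := S.weight_pos x.1
      have p2 := S.weight_pos x.2
      have p := S.weight_pos d
      rw [norm_mul]
      refine mul_le_mul ((ih _).trans ?_) ((hf _).trans ?_) (norm_nonneg _) (by positivity)
      all_goals gcongr
    refine (norm_sum_le _ _).trans ((Finset.sum_le_card_nsmul _ _ _ hbd).trans ?_)
    have p := S.weight_pos d
    rw [nsmul_eq_mul]
    calc _ ≤ D * S.weight d ^ η * (D ^ (2 * k) * S.weight d ^ (2 * k * η) *
          (D * S.weight d ^ η)) := by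
          gcongr
          exact hdiv d
      _ = D ^ (2 * (k + 1)) * (S.weight d ^ (2 * k * η) * S.weight d ^ η * S.weight d ^ η) := by
          ring
      _ = _ := by
          rw [← Real.rpow_add p, ← Real.rpow_add p]
          push_cast
          ring_nf

/-- The moment bounds of Montgomery's conjecture for Dirichlet polynomials over `S`. -/
def MomentBound (S : BeurlingSystem) (θ : ℝ) : Prop :=
  ∀ ε > (0:ℝ), ∃ Cε : ℝ, ∀ (a : ℕ → ℂ) (N T₀ T ν : ℝ),
      (∀ j, ‖a j‖ ≤ 1) → 2 ≤ N → 0 < T → 1 ≤ ν → ν ≤ 2 →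
      (∫ t in T₀..T₀ + T,
          ‖∑' j : ℕ, Set.indicator {j : ℕ | S.n j ≤ N}
            (fun j => a j * (S.n j : ℂ) ^ (-(Complex.I * (t : ℂ)))) j‖ ^ (2 * ν))
        ≤ Cε * (T * N ^ (ν * θ) + N ^ ν) * N ^ (ν + ε)

lemma MomentBound.integral_dirichletEval_le {θ : ℝ} (h : S.MomentBound θ) {ε : ℝ} (hε : 0 < ε) :
    ∃ K > 0, ∀ (f : MvPolynomial ℕ ℂ) (B N T₀ T ν σ : ℝ), 0 < B →
      (∀ d, ‖f.coeff d‖ * S.weight d ^ (-σ) ≤ B) → (∀ d, f.coeff d ≠ 0 → S.weight d ≤ N) →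
      2 ≤ N → 0 < T → 1 ≤ ν → ν ≤ 2 →
      ∫ t in T₀..T₀ + T, ‖S.dirichletEval (σ + t * Complex.I) f‖ ^ (2 * ν) ≤
        B ^ (2 * ν) * (K * (T * N ^ (ν * θ) + N ^ ν) * N ^ (ν + ε)) := by
  obtain ⟨K, hK⟩ := h ε hε
  refine ⟨max K 1, by positivity, fun f B N T₀ T ν σ hB hf hN hN2 hT hν1 hν2 => ?_⟩
  set a : ℕ → ℂ := fun j =>
    f.coeff (S.equiv.symm j) * ((S.n j ^ (-σ) / B : ℝ) : ℂ) with ha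
  have ha1 : ∀ j, ‖a j‖ ≤ 1 := fun j => by
    have hw := S.weight_pos (S.equiv.symm j)
    rw [ha]
    simp only [n_eq_weight]
    rw [norm_mul, Complex.norm_real, Real.norm_of_nonneg (by positivity), ← mul_div_assoc,
      div_le_one hB]
    exact hf _
  have heq : ∀ t : ℝ, S.dirichletEval (σ + t * Complex.I) f =
      B * ∑' j : ℕ, Set.indicator {j : ℕ | S.n j ≤ N}
            (fun j => a j * (S.n j : ℂ) ^ (-(Complex.I * (t : ℂ)))) j := fun t => by
    have h1 : ∀ j ∉ f.support.map S.equiv.toEmbedding, Set.indicator {j : ℕ | S.n j ≤ N}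
            (fun j => a j * (S.n j : ℂ) ^ (-(Complex.I * (t : ℂ)))) j = 0 := fun j hj => by
      have : f.coeff (S.equiv.symm j) = 0 := by
        simpa [Finset.mem_map_equiv] using hj
      simp [Set.indicator, ha, this]
    rw [tsum_eq_sum h1, Finset.sum_map, dirichletEval_eq, Finset.mul_sum]
    refine Finset.sum_congr rfl fun d hd => ?_
    have hw := S.weight_pos d
    have hd' : S.n (S.equiv d) ≤ N := hN d (MvPolynomial.mem_support_iff.1 hd)
    rw [Equiv.coe_toEmbedding, Set.indicator_of_mem (by exact hd')]
    have hB' : (B : ℂ) ≠ 0 := Complex.ofReal_ne_zero.2 hB.ne'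
    have h2 : (S.weight d : ℂ) ^ (-(σ + t * Complex.I : ℂ)) =
        ((S.weight d ^ (-σ) : ℝ) : ℂ) * (S.weight d : ℂ) ^ (-(Complex.I * (t : ℂ))) := by
      rw [Complex.ofReal_cpow hw.le, ← Complex.cpow_add _ _ (Complex.ofReal_ne_zero.2 hw.ne')]
      congr 1
      push_cast
      ring
    rw [h2]
    simp only [ha, Equiv.symm_apply_apply, n_eq_weight]
    push_cast
    field_simp
  have hpow : ∀ t : ℝ, ‖S.dirichletEval (σ + t * Complex.I) f‖ ^ (2 * ν) =
      B ^ (2 * ν) * ‖∑' j : ℕ, Set.indicator {j : ℕ | S.n j ≤ N}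
            (fun j => a j * (S.n j : ℂ) ^ (-(Complex.I * (t : ℂ)))) j‖ ^ (2 * ν) := fun t => by
    rw [heq, norm_mul, Complex.norm_real, Real.norm_of_nonneg hB.le,
      Real.mul_rpow hB.le (norm_nonneg _)]
  simp only [hpow]
  rw [intervalIntegral.integral_const_mul]
  have hN0 : 0 < N := by linarith
  gcongr
  refine (hK a N T₀ T ν ha1 hN2 hT hν1 hν2).trans ?_
  gcongr
  exact le_max_left _ _

end BeurlingSystem

end

section

open Finset.HasAntidiagonal

namespace BeurlingSystem

variable {S : BeurlingSystem} {θ A C : ℝ} {Z : ℂ → ℂ}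

/-- The truncated reciprocal of the zeta function, as a polynomial in the primes. -/
noncomputable def mollifier (S : BeurlingSystem) (X : ℝ) : MvPolynomial ℕ ℂ :=
  ∑ k ∈ S.upTo X, MvPolynomial.monomial k (mobius k)

/-- The truncated zeta function, as a polynomial in the primes. -/
noncomputable def zetaPoly (S : BeurlingSystem) (x : ℝ) : MvPolynomial ℕ ℂ :=
  ∑ k ∈ S.upTo x, MvPolynomial.monomial k 1

/-- The deviation from `1` of the product of the truncated zeta function with its mollifier. -/
noncomputable def remainder (S : BeurlingSystem) (X x : ℝ) : MvPolynomial ℕ ℂ :=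
  S.mollifier X * S.zetaPoly x - 1

lemma coeff_mollifier (X : ℝ) (d : ℕ →₀ ℕ) :
    (S.mollifier X).coeff d = if d ∈ S.upTo X then mobius d else 0 := by
  simp [mollifier, MvPolynomial.coeff_sum, MvPolynomial.coeff_monomial]

lemma coeff_zetaPoly (x : ℝ) (d : ℕ →₀ ℕ) :
    (S.zetaPoly x).coeff d = if d ∈ S.upTo x then 1 else 0 := by
  simp [zetaPoly, MvPolynomial.coeff_sum, MvPolynomial.coeff_monomial]

lemma norm_coeff_remainder_le (hS : S.WellBehaved θ A C) {X x : ℝ} (hX : 1 ≤ X) (hx : 1 ≤ x)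
    (d : ℕ →₀ ℕ) : ‖(S.remainder X x).coeff d‖ ≤ (antidiagonal d).card := by
  rw [remainder, MvPolynomial.coeff_sub, MvPolynomial.coeff_mul, MvPolynomial.coeff_one]
  rcases eq_or_ne d 0 with rfl | hd
  · simp [coeff_mollifier, coeff_zetaPoly, hS.mem_upTo, weight_zero, hX, hx, mobius]
  · rw [if_neg hd.symm, sub_zero]
    refine (norm_sum_le _ _).trans ((Finset.sum_le_card_nsmul _ _ 1 fun y _ => ?_).trans (by simp))
    rw [coeff_mollifier, coeff_zetaPoly, norm_mul]
    refine mul_le_one₀ ?_ (norm_nonneg _) ?_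
    · split_ifs
      · exact norm_mobius_le _
      · simp
    · split_ifs <;> simp

lemma coeff_remainder_ne_zero (hS : S.WellBehaved θ A C) {X x : ℝ} (hX : 1 ≤ X) (hXx : X ≤ x)
    {d : ℕ →₀ ℕ} (hd : (S.remainder X x).coeff d ≠ 0) :
    X < S.weight d ∧ S.weight d ≤ X * x := by
  have hd0 : d ≠ 0 := by
    rintro rfl
    refine hd ?_
    simp [remainder, MvPolynomial.coeff_mul, coeff_mollifier, coeff_zetaPoly, hS.mem_upTo,
      weight_zero, hX, hX.trans hXx, mobius]
  rw [remainder, MvPolynomial.coeff_sub, MvPolynomial.coeff_one, if_neg hd0.symm, sub_zero,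
    MvPolynomial.coeff_mul] at hd
  have hw := S.one_le_weight
  have hpos := S.weight_pos
  constructor
  · by_contra! hle
    refine hd (Eq.trans (Finset.sum_congr rfl fun y hy => ?_) (sum_antidiagonal_mobius hd0))
    have hy := mem_antidiagonal.1 hy
    have h1 : S.weight y.1 ≤ X := by
      refine le_trans ?_ hle
      rw [← hy, weight_add]
      exact le_mul_of_one_le_right (hpos _).le (hw _)
    have h2 : S.weight y.2 ≤ x := by
      refine le_trans ?_ (hle.trans hXx)
      rw [← hy, weight_add]
      exact le_mul_of_one_le_left (hpos _).le (hw _)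
    rw [coeff_mollifier, coeff_zetaPoly, if_pos (hS.mem_upTo.2 h1), if_pos (hS.mem_upTo.2 h2),
      mul_one]
  · obtain ⟨y, hy, hy0⟩ := Finset.exists_ne_zero_of_sum_ne_zero hd
    rw [coeff_mollifier, coeff_zetaPoly] at hy0
    have h1 := hS.mem_upTo.1 (ite_ne_right_iff.1 (left_ne_zero_of_mul hy0)).1
    have h2 := hS.mem_upTo.1 (ite_ne_right_iff.1 (right_ne_zero_of_mul hy0)).1
    rw [← mem_antidiagonal.1 hy, weight_add]
    exact mul_le_mul h1 h2 (hpos _).le (by linarith)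

open Classical in
/-- The part of a Dirichlet polynomial supported on the generalized integers in `(L, R]`. -/
noncomputable def block (S : BeurlingSystem) (f : MvPolynomial ℕ ℂ) (L R : ℝ) :
    MvPolynomial ℕ ℂ :=
  ∑ d ∈ f.support with L < S.weight d ∧ S.weight d ≤ R, MvPolynomial.monomial d (f.coeff d)

open Classical in
lemma coeff_block (f : MvPolynomial ℕ ℂ) (L R : ℝ) (d : ℕ →₀ ℕ) :
    (S.block f L R).coeff d = if L < S.weight d ∧ S.weight d ≤ R then f.coeff d else 0 := by
  rw [block, MvPolynomial.coeff_sum]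
  simp only [MvPolynomial.coeff_monomial]
  rw [Finset.sum_ite_eq']
  simp only [Finset.mem_filter, MvPolynomial.mem_support_iff]
  split_ifs with h1 h2 h2
  · rfl
  · exact absurd h1.2 h2
  · by_contra h
    exact h1 ⟨Ne.symm h, h2⟩
  · rfl

lemma block_eq_sum (f : MvPolynomial ℕ ℂ) {Q : ℝ} (hQ : 1 ≤ Q) {m n : ℕ} (hmn : m ≤ n) :
    S.block f (Q ^ m) (Q ^ n) = ∑ i ∈ Finset.Ico m n, S.block f (Q ^ i) (Q ^ (i + 1)) := by
  induction n, hmn using Nat.le_induction with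
  | base =>
    ext d
    rw [coeff_block, if_neg (fun h => absurd h.1 (not_lt.2 h.2))]
    simp
  | succ n hmn ih =>
    rw [Finset.sum_Ico_succ_top hmn, ← ih]
    ext d
    rw [MvPolynomial.coeff_add, coeff_block, coeff_block, coeff_block]
    have h1 : Q ^ m ≤ Q ^ n := pow_le_pow_right₀ hQ hmn
    have h2 : Q ^ n ≤ Q ^ (n + 1) := pow_le_pow_right₀ hQ n.le_succ
    by_cases h : S.weight d ≤ Q ^ n
    · rw [if_neg (fun h' : Q ^ n < _ ∧ _ => absurd h'.1 (not_lt.2 h)), add_zero]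
      simp only [h, h.trans h2]
    · rw [if_neg (fun h' : _ ∧ S.weight d ≤ Q ^ n => absurd h'.2 h), zero_add]
      simp only [not_le.1 h, h1.trans_lt (not_le.1 h)]

lemma remainder_eq_sum (hS : S.WellBehaved θ A C) {Q : ℝ} (hQ : 1 ≤ Q) {m n : ℕ} :
    S.remainder (Q ^ m) (Q ^ (m + n)) = ∑ i ∈ Finset.Ico m (2 * m + n),
      S.block (S.remainder (Q ^ m) (Q ^ (m + n))) (Q ^ i) (Q ^ (i + 1)) := by
  rw [← block_eq_sum _ hQ (by omega)]
  ext d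
  rw [coeff_block]
  split_ifs with h
  · rfl
  · by_contra h0
    have := coeff_remainder_ne_zero hS (one_le_pow₀ hQ) (pow_le_pow_right₀ hQ (by omega)) h0
    rw [← pow_add, ← add_assoc, ← two_mul] at this
    exact h this

lemma norm_mollifier_le (hS : S.WellBehaved θ A C) {D X : ℝ}
    (hD : ∀ u : ℝ, 1 ≤ u → (S.Nint u : ℝ) ≤ D * u) (hX : 1 ≤ X) {s : ℂ} (hs : 0 ≤ s.re) :
    ‖S.dirichletEval s (S.mollifier X)‖ ≤ D * X := by
  refine le_trans ?_ (hD X hX)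
  rw [mollifier, map_sum, ← hS.card_upTo]
  refine (norm_sum_le _ _).trans ((Finset.sum_le_card_nsmul _ _ 1 fun d _ => ?_).trans (by simp))
  rw [dirichletEval_monomial, norm_mul, norm_weight_cpow]
  refine mul_le_one₀ (norm_mobius_le d) (Real.rpow_nonneg (S.weight_pos d).le _) ?_
  exact Real.rpow_le_one_of_one_le_of_nonpos (S.one_le_weight d) (by linarith)

/-- The mollified zeta function at a zero. -/
lemma one_add_remainder_eq (hS : S.WellBehaved θ A C) (hZ : S.IsZeta θ A Z) {X x : ℝ}
    (hx : 1 ≤ x) {ρ : ℂ} (hρ : Z ρ = 0) (hre : θ < ρ.re) (h1 : ρ ≠ 1) :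
    1 + S.dirichletEval ρ (S.remainder X x) = S.dirichletEval ρ (S.mollifier X) *
      (S.err A x * (x : ℂ) ^ (-ρ) - ρ * tailMellin (S.err A) x ρ -
        A * (x : ℂ) ^ (1 - ρ) / (ρ - 1)) := by
  have h := hS.zetaReg_eq hZ hx hre
  have h1' := sub_ne_zero.2 h1
  rw [zetaReg_of_ne h1, hρ, mul_zero] at h
  rw [remainder, map_sub, map_mul, map_one, add_sub_cancel]
  congr 1
  have hV : S.dirichletEval ρ (S.zetaPoly x) = ∑ k ∈ S.upTo x, (S.weight k : ℂ) ^ (-ρ) := by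
    simp only [zetaPoly, map_sum, dirichletEval_monomial, one_mul]
  rw [hV]
  field_simp
  linear_combination -h

/-- A zero is detected by a block of the mollified polynomial, by the tail of the zeta function, or
it is close to the real axis. -/
lemma one_le_of_zero (hS : S.WellBehaved θ A C) (hZ : S.IsZeta θ A Z) {D Q : ℝ}
    (hD : ∀ u : ℝ, 1 ≤ u → (S.Nint u : ℝ) ≤ D * u) (hQ : 1 ≤ Q) {m n : ℕ} {α H : ℝ} {ρ : ℂ}
    (hρ : Z ρ = 0) (hα : θ < α) (hre : α ≤ ρ.re) (hH : 0 < H) (him : H ≤ |ρ.im|) :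
    1 ≤ ∑ i ∈ Finset.Ico m (2 * m + n), ‖S.dirichletEval ρ
        (S.block (S.remainder (Q ^ m) (Q ^ (m + n))) (Q ^ i) (Q ^ (i + 1)))‖ +
      D * Q ^ m * (C * (Q ^ (m + n)) ^ (θ - α) + ‖ρ‖ * ‖tailMellin (S.err A) (Q ^ (m + n)) ρ‖ +
        A * (Q ^ (m + n)) ^ (1 - α) / H) := by
  have hx : 1 ≤ Q ^ (m + n) := one_le_pow₀ hQ
  have hx0 : 0 < Q ^ (m + n) := by positivity
  have hC := hS.const_pos
  have hA := hS.density_pos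
  have hθ := hS.nonneg
  have h1 : ρ ≠ 1 := by
    rintro rfl
    rw [Complex.one_im, abs_zero] at him
    linarith
  have key := one_add_remainder_eq (X := Q ^ m) hS hZ hx hρ (hα.trans_le hre) h1
  have hM := norm_mollifier_le hS hD (one_le_pow₀ hQ : 1 ≤ Q ^ m) (s := ρ) (by linarith)
  have hP : ‖S.dirichletEval ρ (S.remainder (Q ^ m) (Q ^ (m + n)))‖ ≤
      ∑ i ∈ Finset.Ico m (2 * m + n), ‖S.dirichletEval ρ
        (S.block (S.remainder (Q ^ m) (Q ^ (m + n))) (Q ^ i) (Q ^ (i + 1)))‖ := by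
    conv_lhs => rw [remainder_eq_sum hS hQ, map_sum]
    exact norm_sum_le _ _
  have hE : ‖(S.err A (Q ^ (m + n)) : ℂ) * ((Q ^ (m + n) : ℝ) : ℂ) ^ (-ρ)‖ ≤
      C * (Q ^ (m + n)) ^ (θ - α) := by
    rw [norm_mul, Complex.norm_real, Complex.norm_cpow_eq_rpow_re_of_pos hx0, Complex.neg_re,
      Real.norm_eq_abs]
    calc _ ≤ C * (Q ^ (m + n)) ^ θ * (Q ^ (m + n)) ^ (-α) := by
          gcongr
          exact hS.abs_err_le hx
      _ = _ := by rw [mul_assoc, ← Real.rpow_add hx0, sub_eq_add_neg]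
  have hpole : ‖(A : ℂ) * ((Q ^ (m + n) : ℝ) : ℂ) ^ (1 - ρ) / (ρ - 1)‖ ≤
      A * (Q ^ (m + n)) ^ (1 - α) / H := by
    rw [norm_div, norm_mul, Complex.norm_real, Complex.norm_cpow_eq_rpow_re_of_pos hx0,
      Complex.sub_re, Complex.one_re, Real.norm_of_nonneg hA.le]
    gcongr
    refine him.trans ?_
    simpa using Complex.abs_im_le_norm (ρ - 1)
  have hbig : ‖1 + S.dirichletEval ρ (S.remainder (Q ^ m) (Q ^ (m + n)))‖ ≤ D * Q ^ m *
      (C * (Q ^ (m + n)) ^ (θ - α) + ‖ρ‖ * ‖tailMellin (S.err A) (Q ^ (m + n)) ρ‖ +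
        A * (Q ^ (m + n)) ^ (1 - α) / H) := by
    rw [key, norm_mul]
    refine mul_le_mul hM ?_ (norm_nonneg _) ((norm_nonneg _).trans hM)
    refine (norm_sub_le _ _).trans (add_le_add ((norm_sub_le _ _).trans (add_le_add hE ?_)) hpole)
    rw [norm_mul]
  have h3 := norm_sub_le (1 + S.dirichletEval ρ (S.remainder (Q ^ m) (Q ^ (m + n))))
    (S.dirichletEval ρ (S.remainder (Q ^ m) (Q ^ (m + n))))
  rw [add_sub_cancel_right, norm_one] at h3
  linarith

end BeurlingSystem

end

section

open MeasureTheory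

namespace BeurlingSystem

variable {S : BeurlingSystem} {θ A C : ℝ} {Z : ℂ → ℂ}

/-- A large value estimate at the zeros of `Z` from a moment estimate. -/
theorem WellBehaved.exists_card_zeros_mul_le (hS : S.WellBehaved θ A C) (hZ : S.IsZeta θ A Z)
    {r : ℝ} (hr : 0 < r) (hrθ : r ≤ (1 - θ) / 8) :
    ∃ K > 0, ∀ (f : ℂ → ℂ) (F : Finset ℂ) (α T p v I : ℝ), (1 + θ) / 2 ≤ α → 2 ≤ T → 1 ≤ p →
      0 ≤ v → 0 ≤ I → DifferentiableOn ℂ f {s | θ < s.re} →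
      (∀ ρ ∈ F, Z ρ = 0 ∧ α ≤ ρ.re ∧ |ρ.im| ≤ T ∧ v ≤ ‖f ρ‖) →
      (∀ σ : ℝ, α - r ≤ σ → ∫ t in (-2 * T)..(-2 * T + 4 * T), ‖f (σ + t * Complex.I)‖ ^ p ≤ I) →
        F.card * v ^ p ≤ K * Real.log (T + 3) * I := by
  classical
  obtain ⟨K, hK0, hK⟩ := hS.exists_card_zeros_window_le hZ
  have hθ0 := hS.nonneg
  have hθ1 := hS.lt_one
  refine ⟨(Real.pi * r ^ 2)⁻¹ * (2 * K), by positivity,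
    fun f F α T p v I hα hT hp hv hI hf hF hintegral => ?_⟩
  rcases F.eq_empty_or_nonempty with rfl | hne
  · have : 0 ≤ Real.log (T + 3) := Real.log_nonneg (by linarith)
    simp only [Finset.card_empty, Nat.cast_zero, zero_mul]
    positivity
  have hre1 : ∀ ρ ∈ F, ρ.re ≤ 1 := fun ρ hρ => by
    by_contra hcon
    exact hS.ne_zero_of_one_lt_re hZ (not_le.1 hcon) (hF ρ hρ).1
  have hα1 : α ≤ 1 := by
    obtain ⟨ρ, hρ⟩ := hne
    exact (hF ρ hρ).2.1.trans (hre1 ρ hρ)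
  have hlog : 0 ≤ K * Real.log (T + 3) := mul_nonneg hK0.le (Real.log_nonneg (by linarith))
  have hB : ∀ z, (F.filter fun ρ => dist z ρ < r).card ≤ ⌊K * Real.log (T + 3)⌋₊ := fun z => by
    rcases (F.filter fun ρ => dist z ρ < r).eq_empty_or_nonempty with h | ⟨ρ₀, hρ₀⟩
    · rw [h]
      simp
    · have him : ∀ ρ ∈ F.filter fun ρ => dist z ρ < r, |ρ.im - z.im| ≤ r := fun ρ hρ => by
        have h1 := (Finset.mem_filter.1 hρ).2
        rw [dist_comm, dist_eq_norm] at h1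
        simpa using (Complex.abs_im_le_norm (ρ - z)).trans h1.le
      refine Nat.le_floor ((hK z.im _ fun ρ hρ => ?_).trans ?_)
      · have h1 := hF ρ (Finset.mem_filter.1 hρ).1
        exact ⟨h1.1, hα.trans h1.2.1, (him ρ hρ).trans hrθ⟩
      · refine mul_le_mul_of_nonneg_left (Real.log_le_log (by positivity) ?_) hK0.le
        have h1 := (hF ρ₀ (Finset.mem_filter.1 hρ₀).1).2.2.1
        have h2 := him ρ₀ hρ₀
        have h3 := abs_sub_abs_le_abs_sub z.im ρ₀.im
        rw [abs_sub_comm] at h3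
        linarith
  have hball : ∀ ρ ∈ F, Metric.closedBall ρ r ⊆
      Set.Icc (α - r) (1 + r) ×ℂ Set.Icc (-2 * T) (-2 * T + 4 * T) := fun ρ hρ z hz => by
    rw [mem_closedBall_iff_norm] at hz
    have h1 := abs_le.1 ((Complex.abs_re_le_norm (z - ρ)).trans hz)
    have h2 := abs_le.1 ((Complex.abs_im_le_norm (z - ρ)).trans hz)
    have h3 := abs_le.1 (hF ρ hρ).2.2.1
    have h4 := hre1 ρ hρ
    have h5 := (hF ρ hρ).2.1
    rw [Complex.sub_re] at h1
    rw [Complex.sub_im] at h2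
    rw [Complex.mem_reProdIm, Set.mem_Icc, Set.mem_Icc]
    refine ⟨⟨?_, ?_⟩, ?_, ?_⟩ <;> linarith
  have key := sum_norm_rpow_le (f := f) (F := F) (p := p) (by linarith) (by linarith) hr hp
    (hf.mono fun z hz => by
      have := (Complex.mem_reProdIm.1 hz).1.1
      simp only [Set.mem_ofPred_eq]
      linarith) hball hB fun σ hσ => hintegral σ hσ.1
  calc F.card * v ^ p = ∑ _ρ ∈ F, v ^ p := by simp
    _ ≤ ∑ ρ ∈ F, ‖f ρ‖ ^ p := Finset.sum_le_sum fun ρ hρ =>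
        Real.rpow_le_rpow hv (hF ρ hρ).2.2.2 (by linarith)
    _ ≤ _ := key
    _ ≤ (Real.pi * r ^ 2)⁻¹ * (K * Real.log (T + 3) * (2 * I)) := by
        have h1 : 0 ≤ 1 + r - (α - r) := by linarith
        gcongr
        · exact Nat.floor_le hlog
        · linarith
    _ = _ := by ring

/-- Only few zeros make the tail of the zeta function large. -/
theorem WellBehaved.exists_card_zeros_tailMellin_le (hS : S.WellBehaved θ A C)
    (hZ : S.IsZeta θ A Z) {r : ℝ} (hr : 0 < r) (hrθ : r ≤ (1 - θ) / 8) :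
    ∃ K > 0, ∀ (F : Finset ℂ) (α T v x : ℝ), (1 + θ) / 2 ≤ α → 2 ≤ T → 0 < v → 1 ≤ x →
      (∀ ρ ∈ F, Z ρ = 0 ∧ α ≤ ρ.re ∧ |ρ.im| ≤ T ∧ v ≤ ‖tailMellin (S.err A) x ρ‖) →
        (F.card : ℝ) ≤ K * Real.log (T + 3) * x ^ (2 * (θ - α + r)) / v ^ 2 := by
  obtain ⟨K, hK0, hK⟩ := hS.exists_card_zeros_mul_le hZ hr hrθ
  have hC := hS.const_pos
  have hθ1 := hS.lt_one
  refine ⟨K * (2 * Real.pi * (C ^ 2 / (2 * ((1 - θ) / 4)))), ?_, fun F α T v x hα hT hv hx hF => ?_⟩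
  · have : 0 < 1 - θ := by linarith
    positivity
  have hx0 : 0 < x := by linarith
  have h4 : 0 < (1 - θ) / 4 := by linarith
  have := hK (tailMellin (S.err A) x) F α T 2 v
    (2 * Real.pi * (C ^ 2 * (x ^ (2 * (θ - α + r)) / (2 * ((1 - θ) / 4))))) hα hT one_le_two hv.le
    (by positivity) (fun s hs => (differentiableAt_tailMellin hS.measurable_err hx
      (fun u hu => hS.abs_err_le hu) hs).differentiableWithinAt) hF fun σ hσ => ?_
  · rw [Real.rpow_two] at this
    rw [le_div_iff₀ (by positivity)]
    refine this.trans_eq ?_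
    ring
  · have hσθ : θ < σ := by linarith
    obtain ⟨hi, hle⟩ := integral_norm_sq_tailMellin_le hS.measurable_err hx
      (fun u hu => hS.abs_err_le hu) hσθ
    simp only [Real.rpow_two]
    rw [intervalIntegral.integral_of_le (by linarith)]
    refine (setIntegral_le_integral hi (Filter.Eventually.of_forall fun t => by positivity)).trans
      (hle.trans ?_)
    gcongr
    · linarith
    · linarith

end BeurlingSystem

end

section

open Finset.HasAntidiagonal

namespace BeurlingSystem

variable {S : BeurlingSystem} {θ A C : ℝ} {Z : ℂ → ℂ}

/-- An exponent `k` and a moment order `ν` with `i k ν = m ^ 2`. -/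
lemma exists_exponent {m i : ℕ} (hm : 1 ≤ m) (hmi : m ≤ i) (him : i ≤ m ^ 2) :
    ∃ (k : ℕ) (ν : ℝ), 1 ≤ k ∧ 1 ≤ ν ∧ ν ≤ 2 ∧ i * k * ν = (m : ℝ) ^ 2 ∧ k * ν ≤ m := by
  have hi : 0 < i := by omega
  have hk : 1 ≤ m ^ 2 / i := (Nat.one_le_div_iff hi).2 him
  have h1 : m ^ 2 / i * i ≤ m ^ 2 := Nat.div_mul_le_self _ _
  have h2 : m ^ 2 < i * (m ^ 2 / i + 1) := Nat.lt_mul_div_succ _ hi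
  set k := m ^ 2 / i with hkdef
  have hpos : (0 : ℝ) < i * k := by exact_mod_cast Nat.mul_pos hi hk
  have h1' : (k * i : ℝ) ≤ (m : ℝ) ^ 2 := by exact_mod_cast h1
  have h2' : (m : ℝ) ^ 2 < i * (k + 1) := by exact_mod_cast h2
  have hk' : (1 : ℝ) ≤ k := by exact_mod_cast hk
  have hi' : (0 : ℝ) < i := by exact_mod_cast hi
  have hmi' : (m : ℝ) ≤ i := by exact_mod_cast hmi
  refine ⟨k, (m : ℝ) ^ 2 / (i * k), hk, ?_, ?_, by field_simp, ?_⟩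
  · rw [le_div_iff₀ hpos]
    linarith
  · rw [div_le_iff₀ hpos]
    nlinarith
  · have : (k : ℝ) * ((m : ℝ) ^ 2 / (i * k)) = m ^ 2 / i := by field_simp
    rw [this, div_le_iff₀ hi']
    nlinarith [(Nat.cast_nonneg m : (0 : ℝ) ≤ m)]

lemma integral_block_pow_le (h : S.MomentBound θ) (hθ1 : θ ≤ 1) {D η ε : ℝ} (hD : 1 ≤ D)
    (hη : 0 ≤ η) (hε : 0 < ε) (hdiv : ∀ n, ((antidiagonal n).card : ℝ) ≤ D * S.weight n ^ η)
    {m : ℕ} (hm : 1 ≤ m) :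
    ∃ K > 0, ∀ (f : MvPolynomial ℕ ℂ) (Q T σ ν : ℝ) (i k : ℕ), 2 ≤ Q → 0 < T →
      T ≤ Q ^ (m ^ 2 * (1 - θ)) → 0 ≤ σ → 1 ≤ ν → ν ≤ 2 → 1 ≤ k → m ≤ i →
      i * k * ν = (m : ℝ) ^ 2 → k * ν ≤ m →
      (∀ d, ‖f.coeff d‖ ≤ (antidiagonal d).card) →
      ∫ t in (-2 * T)..(-2 * T + 4 * T),
        ‖S.dirichletEval (σ + t * Complex.I) (S.block f (Q ^ i) (Q ^ (i + 1)) ^ k)‖ ^ (2 * ν) ≤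
        K * Q ^ (m ^ 2 * (2 - 2 * σ + 8 * m * η + 2 / m + 2 * ε)) := by
  obtain ⟨K, hK0, hK⟩ := h.integral_dirichletEval_le hε
  refine ⟨D ^ (4 * m : ℝ) * (5 * K), by positivity,
    fun f Q T σ ν i k hQ hT hTQ hσ hν1 hν2 hk hi hikν hkν hf => ?_⟩
  have hQ1 : 1 ≤ Q := by linarith
  have hQ0 : 0 < Q := by linarith
  have hm' : (1 : ℝ) ≤ m := by exact_mod_cast hm
  have hk' : (1 : ℝ) ≤ k := by exact_mod_cast hk
  have hmi : (m : ℝ) ≤ i := by exact_mod_cast hi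
  set g := S.block f (Q ^ i) (Q ^ (i + 1)) with hg
  have hgcoef : ∀ d, ‖g.coeff d‖ ≤ D * S.weight d ^ η := fun d => by
    classical
    rw [hg, coeff_block]
    have := S.weight_pos d
    split_ifs
    · exact (hf d).trans (hdiv d)
    · rw [norm_zero]
      positivity
  have hgsupp : ∀ d, g.coeff d ≠ 0 → Q ^ i ≤ S.weight d ∧ S.weight d ≤ Q ^ (i + 1) := fun d hd => by
    classical
    rw [hg, coeff_block] at hd
    have := (ite_ne_right_iff.1 hd).1
    exact ⟨this.1.le, this.2⟩
  have hsupp := coeff_pow_ne_zero (by positivity) hgsupp k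
  have hcoef := norm_coeff_pow_le hD hη hdiv hgcoef k
  set N := (Q ^ (i + 1)) ^ k with hN
  have hNQ : N = Q ^ (((i : ℝ) + 1) * k) := by
    rw [hN, ← pow_mul, ← Real.rpow_natCast]
    push_cast
    rfl
  have hLQ : (Q ^ i) ^ k = Q ^ ((i : ℝ) * k) := by
    rw [← pow_mul, ← Real.rpow_natCast]
    push_cast
    rfl
  set B := D ^ (2 * k) * Q ^ (((i : ℝ) + 1) * k * (2 * k * η) - i * k * σ) with hB
  have hB0 : 0 < B := by positivity
  have hBd : ∀ d, ‖(g ^ k).coeff d‖ * S.weight d ^ (-σ) ≤ B := fun d => by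
    by_cases hd : (g ^ k).coeff d = 0
    · rw [hd, norm_zero, zero_mul]
      exact hB0.le
    · obtain ⟨h1, h2⟩ := hsupp d hd
      have hw := S.weight_pos d
      rw [hLQ] at h1
      rw [hNQ] at h2
      calc _ ≤ D ^ (2 * k) * S.weight d ^ (2 * k * η) * S.weight d ^ (-σ) := by
            gcongr
            exact hcoef d
        _ ≤ D ^ (2 * k) * (Q ^ (((i : ℝ) + 1) * k)) ^ (2 * k * η) * (Q ^ ((i : ℝ) * k)) ^ (-σ) := by
            refine mul_le_mul ?_ (Real.rpow_le_rpow_of_nonpos (by positivity) h1 (by linarith))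
              (by positivity) (by positivity)
            gcongr
        _ = B := by
            rw [hB, ← Real.rpow_mul hQ0.le, ← Real.rpow_mul hQ0.le, mul_assoc, ← Real.rpow_add hQ0]
            ring_nf
  have hN2 : 2 ≤ N := by
    have h1 : 1 ≤ (i + 1) * k := Nat.mul_pos (by omega) hk
    rw [hN, ← pow_mul]
    calc (2 : ℝ) ≤ Q ^ 1 := by simpa using hQ
      _ ≤ _ := pow_le_pow_right₀ hQ1 h1
  refine (hK (g ^ k) B N (-2 * T) (4 * T) ν σ hB0 hBd (fun d hd => (hsupp d hd).2) hN2
    (by linarith) hν1 hν2).trans ?_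
  have hN0 : 0 < N := by linarith
  have hNν : N ^ ν = Q ^ ((m : ℝ) ^ 2 + k * ν) := by
    rw [hNQ, ← Real.rpow_mul hQ0.le]
    congr 1
    linear_combination hikν
  have hTN : T * N ^ (ν * θ) ≤ N ^ ν := by
    have h1 : T ≤ N ^ (ν * (1 - θ)) := by
      rw [Real.rpow_mul hN0.le, hNν, ← Real.rpow_mul hQ0.le]
      refine hTQ.trans (Real.rpow_le_rpow_of_exponent_le hQ1 ?_)
      refine mul_le_mul_of_nonneg_right ?_ (by linarith)
      have : 0 ≤ k * ν := by positivity
      linarith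
    calc T * N ^ (ν * θ) ≤ N ^ (ν * (1 - θ)) * N ^ (ν * θ) := by gcongr
      _ = N ^ ν := by
        rw [← Real.rpow_add hN0]
        ring_nf
  have hkm : (k : ℝ) ≤ m := (le_mul_of_one_le_right (by positivity) hν1).trans hkν
  have hmm : (m : ℝ) ≤ (m : ℝ) ^ 2 := by nlinarith
  have hBν : B ^ (2 * ν) ≤ D ^ (4 * m : ℝ) * Q ^ (8 * m ^ 3 * η - 2 * m ^ 2 * σ) := by
    rw [hB, Real.mul_rpow (by positivity) (by positivity), ← Real.rpow_natCast,
      ← Real.rpow_mul (by linarith), ← Real.rpow_mul hQ0.le]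
    refine mul_le_mul (Real.rpow_le_rpow_of_exponent_le hD ?_)
      (Real.rpow_le_rpow_of_exponent_le hQ1 ?_) (by positivity) (by positivity)
    · push_cast
      linarith
    · have h1 : (((i : ℝ) + 1) * k * (2 * k * η) - i * k * σ) * (2 * ν) =
          4 * (k * η) * (m ^ 2 + k * ν) - 2 * m ^ 2 * σ := by
        linear_combination (4 * k * η - 2 * σ) * hikν
      have h2 : 4 * (k * η) * (m ^ 2 + k * ν) ≤ 4 * (m * η) * (m ^ 2 + m ^ 2) := by
        gcongr
        linarith
      rw [h1]
      linarith
  have hNN : N ^ ν * N ^ (ν + ε) ≤ Q ^ (((m : ℝ) ^ 2 + m) * (2 + ε)) := by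
    calc N ^ ν * N ^ (ν + ε) ≤ N ^ ν * N ^ (ν + ν * ε) := by
          gcongr
          · linarith
          · exact le_mul_of_one_le_left hε.le hν1
      _ = (N ^ ν) ^ (2 + ε) := by
          rw [← Real.rpow_add hN0, ← Real.rpow_mul hN0.le]
          ring_nf
      _ ≤ _ := by
          rw [hNν, ← Real.rpow_mul hQ0.le]
          gcongr
  calc _ ≤ B ^ (2 * ν) * (K * (5 * N ^ ν) * N ^ (ν + ε)) := by
        gcongr
        linarith
    _ = B ^ (2 * ν) * (5 * K) * (N ^ ν * N ^ (ν + ε)) := by ring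
    _ ≤ D ^ (4 * m : ℝ) * Q ^ (8 * m ^ 3 * η - 2 * m ^ 2 * σ) * (5 * K) *
        Q ^ (((m : ℝ) ^ 2 + m) * (2 + ε)) := by gcongr
    _ = D ^ (4 * m : ℝ) * (5 * K) * Q ^ (8 * m ^ 3 * η - 2 * m ^ 2 * σ +
        ((m : ℝ) ^ 2 + m) * (2 + ε)) := by
        rw [Real.rpow_add hQ0]
        ring
    _ ≤ _ := by
        gcongr
        have h1 : (m : ℝ) ^ 2 * (2 - 2 * σ + 8 * m * η + 2 / m + 2 * ε) =
            8 * m ^ 3 * η - 2 * m ^ 2 * σ + 2 * m ^ 2 + 2 * m + 2 * m ^ 2 * ε := by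
          field_simp
          ring
        rw [h1]
        nlinarith

end BeurlingSystem

end

section

open Finset.HasAntidiagonal

namespace BeurlingSystem

variable {S : BeurlingSystem} {θ A C : ℝ} {Z : ℂ → ℂ}

lemma log_add_three_le {m : ℕ} (hm : 1 ≤ m) {Q T : ℝ} (hθ0 : 0 ≤ θ) (hQ : 1 ≤ Q) (hT : 2 ≤ T)
    (hTQ : T ≤ Q ^ (m ^ 2 * (1 - θ))) : Real.log (T + 3) ≤ 3 * m * Q ^ (m : ℝ) := by
  have hm' : (1 : ℝ) ≤ m := by exact_mod_cast hm
  have h1 : T ≤ Q ^ ((m : ℝ) ^ 2) := by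
    refine hTQ.trans (Real.rpow_le_rpow_of_exponent_le hQ ?_)
    nlinarith [sq_nonneg (m : ℝ)]
  have hinv : (m : ℝ)⁻¹ ≤ 1 := inv_le_one_of_one_le₀ hm'
  calc Real.log (T + 3) ≤ (T + 3) ^ (m : ℝ)⁻¹ / (m : ℝ)⁻¹ :=
        Real.log_le_rpow_div (by linarith) (by positivity)
    _ ≤ (3 * Q ^ ((m : ℝ) ^ 2)) ^ (m : ℝ)⁻¹ / (m : ℝ)⁻¹ := by
        gcongr
        linarith
    _ = m * 3 ^ (m : ℝ)⁻¹ * Q ^ (m : ℝ) := by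
        rw [Real.mul_rpow (by norm_num) (by positivity), ← Real.rpow_mul (by linarith),
          show (m : ℝ) ^ 2 * (m : ℝ)⁻¹ = m by field_simp]
        field_simp
    _ ≤ m * 3 ^ (1 : ℝ) * Q ^ (m : ℝ) := by
        gcongr
        norm_num
    _ = _ := by
        rw [Real.rpow_one]
        ring

/-- The number of zeros at which a given block of the mollified polynomial is large. -/
theorem WellBehaved.exists_card_zeros_block_le (hS : S.WellBehaved θ A C) (hZ : S.IsZeta θ A Z)
    (h : S.MomentBound θ) {m : ℕ} (hm : 1 ≤ m) :
    ∃ K > 0, ∀ (f : MvPolynomial ℕ ℂ) (F : Finset ℂ) (α T Q : ℝ) (i : ℕ), (1 + θ) / 2 ≤ α →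
      2 ≤ T → 2 ≤ Q → T ≤ Q ^ (m ^ 2 * (1 - θ)) → m ≤ i → i ≤ m ^ 2 →
      (∀ d, ‖f.coeff d‖ ≤ (antidiagonal d).card) →
      (∀ ρ ∈ F, Z ρ = 0 ∧ α ≤ ρ.re ∧ |ρ.im| ≤ T ∧
        1 / (2 * m ^ 2) ≤ ‖S.dirichletEval ρ (S.block f (Q ^ i) (Q ^ (i + 1)))‖) →
        (F.card : ℝ) ≤ K * Q ^ (m ^ 2 * (2 * (1 - α) + 15 / m)) := by
  have hθ0 := hS.nonneg
  have hθ1 := hS.lt_one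
  have hm' : (1 : ℝ) ≤ m := by exact_mod_cast hm
  have hr : 0 < (1 - θ) / (8 * m) := div_pos (by linarith) (by positivity)
  have hrθ : (1 - θ) / (8 * m) ≤ (1 - θ) / 8 :=
    div_le_div_of_nonneg_left (by linarith) (by norm_num) (by linarith)
  have hrm : (1 - θ) / (8 * m) ≤ 1 / m :=
    div_le_div₀ zero_le_one (by linarith) (by positivity) (by linarith)
  set r := (1 - θ) / (8 * m) with hrdef
  obtain ⟨D, hD1, hD⟩ := exists_card_antidiagonal_le S (η := 1 / (m : ℝ) ^ 2) (by positivity)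
  obtain ⟨K₁, hK₁, h₁⟩ := hS.exists_card_zeros_mul_le hZ hr hrθ
  obtain ⟨K₂, hK₂, h₂⟩ := integral_block_pow_le h hθ1.le hD1 (ε := 1 / m) (by positivity)
    (by positivity) hD hm
  refine ⟨K₁ * (3 * m) * K₂ * (2 * m ^ 2) ^ (2 * m : ℝ), by positivity,
    fun f F α T Q i hα hT hQ hTQ hmi him hf hF => ?_⟩
  obtain ⟨k, ν, hk, hν1, hν2, hikν, hkν⟩ := exists_exponent hm hmi him
  have hQ0 : 0 < Q := by linarith
  have hQ1 : 1 ≤ Q := by linarith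
  set v : ℝ := 1 / (2 * m ^ 2) with hv
  have hv0 : 0 < v := by positivity
  have hv1 : v ≤ 1 := by
    rw [hv, div_le_one (by positivity)]
    nlinarith
  have key := h₁ (fun s => S.dirichletEval s (S.block f (Q ^ i) (Q ^ (i + 1)) ^ k)) F α T (2 * ν)
    (v ^ k) (K₂ * Q ^ (m ^ 2 * (2 * (1 - α) + 14 / m))) hα hT (by linarith) (by positivity)
    (by positivity) (differentiable_dirichletEval _).differentiableOn
    (fun ρ hρ => ?_) fun σ hσ => ?_
  · have hvk : v ^ (2 * m : ℝ) ≤ (v ^ k) ^ (2 * ν) := by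
      rw [← Real.rpow_natCast, ← Real.rpow_mul hv0.le]
      exact Real.rpow_le_rpow_of_exponent_ge hv0 hv1 (by linarith)
    have hlog := log_add_three_le hm hθ0 hQ1 hT hTQ
    have hvinv : (2 * (m : ℝ) ^ 2) ^ (2 * m : ℝ) * v ^ (2 * m : ℝ) = 1 := by
      rw [← Real.mul_rpow (by positivity) hv0.le, hv, mul_one_div_cancel (by positivity),
        Real.one_rpow]
    calc (F.card : ℝ) = (2 * (m : ℝ) ^ 2) ^ (2 * m : ℝ) * (F.card * v ^ (2 * m : ℝ)) := by
          linear_combination -(F.card : ℝ) * hvinv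
      _ ≤ (2 * (m : ℝ) ^ 2) ^ (2 * m : ℝ) * (F.card * (v ^ k) ^ (2 * ν)) := by gcongr
      _ ≤ (2 * (m : ℝ) ^ 2) ^ (2 * m : ℝ) * (K₁ * (3 * m * Q ^ (m : ℝ)) *
          (K₂ * Q ^ (m ^ 2 * (2 * (1 - α) + 14 / m)))) := by
          refine mul_le_mul_of_nonneg_left (key.trans ?_) (by positivity)
          gcongr
      _ = K₁ * (3 * m) * K₂ * (2 * m ^ 2) ^ (2 * m : ℝ) *
          (Q ^ (m : ℝ) * Q ^ (m ^ 2 * (2 * (1 - α) + 14 / m))) := by ring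
      _ = _ := by
          rw [← Real.rpow_add hQ0]
          congr 2
          field_simp
          ring
  · obtain ⟨h1, h2, h3, h4⟩ := hF ρ hρ
    refine ⟨h1, h2, h3, ?_⟩
    rw [map_pow, norm_pow]
    gcongr
  · refine (h₂ f Q T σ ν i k hQ (by linarith) hTQ (by linarith) hν1 hν2 hk hmi hikν hkν
      hf).trans ?_
    refine mul_le_mul_of_nonneg_left (Real.rpow_le_rpow_of_exponent_le hQ1
      (mul_le_mul_of_nonneg_left ?_ (by positivity))) hK₂.le
    have h1 : 8 * (m : ℝ) * (1 / (m : ℝ) ^ 2) = 8 / m := by field_simp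
    have h2 : 14 / (m : ℝ) = 14 * (1 / m) := by ring
    have h3 : 8 / (m : ℝ) = 8 * (1 / m) := by ring
    have h4 : 2 / (m : ℝ) = 2 * (1 / m) := by ring
    rw [h1, h2, h3, h4]
    linarith

/-- The number of zeros at which the tail of the zeta function is large. -/
theorem WellBehaved.exists_card_zeros_tail_le (hS : S.WellBehaved θ A C) (hZ : S.IsZeta θ A Z)
    {D : ℝ} (hD : 0 < D) {m n : ℕ} (hm : 1 ≤ m) (hmn : m + (m + n) = m ^ 2) :
    ∃ K > 0, ∀ (F : Finset ℂ) (α T Q : ℝ), (1 + θ) / 2 ≤ α → α ≤ 1 →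
      2 ≤ T → 2 ≤ Q → T ≤ Q ^ (m ^ 2 * (1 - θ)) →
      (∀ ρ ∈ F, Z ρ = 0 ∧ α ≤ ρ.re ∧ |ρ.im| ≤ T ∧
        1 / 8 ≤ D * Q ^ m * (‖ρ‖ * ‖tailMellin (S.err A) (Q ^ (m + n)) ρ‖)) →
        (F.card : ℝ) ≤ K * Q ^ (m ^ 2 * (2 * (1 - α) + 15 / m)) := by
  have hθ0 := hS.nonneg
  have hθ1 := hS.lt_one
  have hm' : (1 : ℝ) ≤ m := by exact_mod_cast hm
  have hr : 0 < (1 - θ) / (8 * m) := div_pos (by linarith) (by positivity)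
  have hrθ : (1 - θ) / (8 * m) ≤ (1 - θ) / 8 :=
    div_le_div_of_nonneg_left (by linarith) (by norm_num) (by linarith)
  have hrm : (1 - θ) / (8 * m) ≤ 1 / m :=
    div_le_div₀ zero_le_one (by linarith) (by positivity) (by linarith)
  set r := (1 - θ) / (8 * m) with hrdef
  obtain ⟨K₁, hK₁, h₁⟩ := hS.exists_card_zeros_tailMellin_le hZ hr hrθ
  refine ⟨K₁ * (3 * m) * (16 * D) ^ 2, by positivity, fun F α T Q hα hα1 hT hQ hTQ hF => ?_⟩
  have hQ0 : 0 < Q := by linarith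
  have hQ1 : 1 ≤ Q := by linarith
  have hv0 : 0 < 1 / (16 * D * T * Q ^ m) := by positivity
  have key := h₁ F α T (1 / (16 * D * T * Q ^ m)) (Q ^ (m + n)) hα hT hv0 (one_le_pow₀ hQ1)
    fun ρ hρ => ?_
  · have hlog := log_add_three_le hm hθ0 hQ1 hT hTQ
    have hx : (Q ^ (m + n)) ^ (2 * (θ - α + r)) =
        Q ^ ((m ^ 2 - m : ℝ) * (2 * (θ - α + r))) := by
      rw [← Real.rpow_natCast, ← Real.rpow_mul hQ0.le]
      congr 2
      rw [← Nat.cast_pow, ← hmn]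
      push_cast
      ring
    rw [hx] at key
    calc (F.card : ℝ) ≤ K₁ * (3 * m * Q ^ (m : ℝ)) * Q ^ ((m ^ 2 - m : ℝ) * (2 * (θ - α + r))) /
          (1 / (16 * D * Q ^ (m ^ 2 * (1 - θ)) * Q ^ m)) ^ 2 := by
          refine key.trans ?_
          gcongr
      _ = K₁ * (3 * m) * (16 * D) ^ 2 * (Q ^ (m : ℝ) * Q ^ ((m ^ 2 - m : ℝ) * (2 * (θ - α + r))) *
          (Q ^ (m ^ 2 * (1 - θ))) ^ 2 * (Q ^ m) ^ 2) := by
          field_simp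
      _ = K₁ * (3 * m) * (16 * D) ^ 2 * Q ^ (m + (m ^ 2 - m : ℝ) * (2 * (θ - α + r)) +
          m ^ 2 * (1 - θ) * 2 + m * 2) := by
          rw [Real.rpow_add hQ0, Real.rpow_add hQ0, Real.rpow_add hQ0, Real.rpow_mul hQ0.le _ 2,
            Real.rpow_mul hQ0.le _ 2, Real.rpow_two, Real.rpow_two, Real.rpow_natCast]
      _ ≤ _ := by
          gcongr
          have h1 : (m : ℝ) ^ 2 * (2 * (1 - α) + 15 / m) = m ^ 2 * (2 * (1 - α)) + 15 * m := by
            field_simp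
          have h2 : (m : ℝ) ^ 2 * r ≤ (m : ℝ) := by
            calc (m : ℝ) ^ 2 * r ≤ (m : ℝ) ^ 2 * (1 / (m : ℝ)) := by gcongr
              _ = (m : ℝ) := by field_simp
          have h3 : (m : ℝ) * (α - θ) ≤ m * 1 := by
            gcongr
            linarith
          have h4 : 0 ≤ (m : ℝ) * r := by positivity
          rw [h1]
          linarith
  · obtain ⟨h1, h2, h3, h4⟩ := hF ρ hρ
    refine ⟨h1, h2, h3, ?_⟩
    have hρ1 : ρ.re ≤ 1 := by
      by_contra hcon
      exact hS.ne_zero_of_one_lt_re hZ (not_le.1 hcon) h1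
    have hρn : ‖ρ‖ ≤ 2 * T := by
      refine (Complex.norm_le_abs_re_add_abs_im ρ).trans ?_
      rw [abs_of_nonneg (by linarith)]
      linarith
    rw [div_le_iff₀ (by positivity)]
    have h5 : 1 / 8 ≤ D * Q ^ m * (2 * T * ‖tailMellin (S.err A) (Q ^ (m + n)) ρ‖) := by
      refine h4.trans ?_
      gcongr
    linarith

end BeurlingSystem

end

section

open Finset.HasAntidiagonal

namespace BeurlingSystem

variable {S : BeurlingSystem} {θ A C : ℝ} {Z : ℂ → ℂ}

/-- A zero of large height makes the tail of the zeta function or a block of the mollified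
polynomial large. -/
lemma tail_or_block_large_of_zero (hS : S.WellBehaved θ A C) (hZ : S.IsZeta θ A Z) {D Q δ : ℝ}
    (hD0 : 0 < D) (hD : ∀ u : ℝ, 1 ≤ u → (S.Nint u : ℝ) ≤ D * u) (hQ : 1 ≤ Q)
    (hQD : 8 * (D * (C + A)) ≤ Q) {m n : ℕ} (hm : 1 ≤ m) (hmn : m + (m + n) = m ^ 2)
    (hmθ : 4 ≤ (m - 1 : ℝ) * (1 - θ)) (hmδ : 8 ≤ m * δ) {α : ℝ} {ρ : ℂ}
    (hρ : Z ρ = 0) (hα : (1 + θ) / 2 ≤ α) (hα1 : α ≤ 1) (hre : α ≤ ρ.re)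
    (him : Q ^ (m ^ 2 * (1 - α) + m ^ 2 * δ) ≤ |ρ.im|) :
    1 / 8 ≤ D * Q ^ m * (‖ρ‖ * ‖tailMellin (S.err A) (Q ^ (m + n)) ρ‖) ∨
      ∃ i ∈ Finset.Ico m (m ^ 2), 1 / (2 * m ^ 2) ≤ ‖S.dirichletEval ρ
        (S.block (S.remainder (Q ^ m) (Q ^ (m + n))) (Q ^ i) (Q ^ (i + 1)))‖ := by
  have hQ0 : 0 < Q := by linarith
  have hθ1 := hS.lt_one
  have hC := hS.const_pos
  have hA := hS.density_pos
  have hm' : (1 : ℝ) ≤ m := by exact_mod_cast hm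
  have hmn' : (m : ℝ) + n = m ^ 2 - m := by
    have : (m : ℝ) + (m + n) = m ^ 2 := by exact_mod_cast hmn
    linarith
  by_contra! hcon
  obtain ⟨htail, hblock⟩ := hcon
  have hone := one_le_of_zero hS hZ hD hQ (m := m) (n := n) hρ (by linarith) hre
    (Real.rpow_pos_of_pos hQ0 _) him
  have hsum : ∑ i ∈ Finset.Ico m (2 * m + n), ‖S.dirichletEval ρ
      (S.block (S.remainder (Q ^ m) (Q ^ (m + n))) (Q ^ i) (Q ^ (i + 1)))‖ ≤ 1 / 2 := by
    rw [show 2 * m + n = m ^ 2 by linarith]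
    refine (Finset.sum_le_card_nsmul _ _ _ fun i hi => (hblock i hi).le).trans ?_
    rw [Nat.card_Ico, nsmul_eq_mul]
    have : ((m ^ 2 - m : ℕ) : ℝ) ≤ m ^ 2 := by exact_mod_cast Nat.sub_le _ _
    calc ((m ^ 2 - m : ℕ) : ℝ) * (1 / (2 * m ^ 2)) ≤ (m : ℝ) ^ 2 * (1 / (2 * m ^ 2)) := by gcongr
      _ = 1 / 2 := by field_simp
  have hx : Q ^ (m + n) = Q ^ (m ^ 2 - m : ℝ) := by
    rw [← Real.rpow_natCast]
    push_cast
    rw [hmn']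
  have h1 : Q ^ m * (Q ^ (m + n)) ^ (θ - α) ≤ Q ^ (-1 : ℝ) := by
    rw [hx, ← Real.rpow_natCast, ← Real.rpow_mul hQ0.le, ← Real.rpow_add hQ0]
    refine Real.rpow_le_rpow_of_exponent_le hQ ?_
    have : (m : ℝ) * 2 ≤ m * ((m - 1) * (α - θ)) := by
      gcongr
      have := mul_le_mul_of_nonneg_left (show (1 - θ) / 2 ≤ α - θ by linarith)
        (sub_nonneg.2 hm')
      linarith
    linarith
  have h2 : Q ^ m * ((Q ^ (m + n)) ^ (1 - α) / Q ^ (m ^ 2 * (1 - α) + m ^ 2 * δ)) ≤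
      Q ^ (-1 : ℝ) := by
    rw [hx, ← Real.rpow_natCast, ← Real.rpow_mul hQ0.le, ← Real.rpow_sub hQ0,
      ← Real.rpow_add hQ0]
    refine Real.rpow_le_rpow_of_exponent_le hQ ?_
    have h3 : (m : ℝ) * 8 ≤ m * (m * δ) := by gcongr
    have h4 : 0 ≤ (m : ℝ) * (1 - α) := mul_nonneg (by linarith) (by linarith)
    linarith
  have h3 : D * (C + A) * Q ^ (-1 : ℝ) ≤ 1 / 8 := by
    rw [Real.rpow_neg_one, ← div_eq_mul_inv, div_le_iff₀ hQ0]
    linarith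
  have h4 := mul_le_mul_of_nonneg_left h1 (mul_pos hD0 hC).le
  have h5 := mul_le_mul_of_nonneg_left h2 (mul_pos hD0 hA).le
  have h6 : A * (Q ^ (m + n)) ^ (1 - α) / Q ^ (m ^ 2 * (1 - α) + m ^ 2 * δ) =
    A * ((Q ^ (m + n)) ^ (1 - α) / Q ^ (m ^ 2 * (1 - α) + m ^ 2 * δ)) := mul_div_assoc _ _ _
  rw [h6] at hone
  linarith

/-- The density estimate at large height, in terms of a power of the height. -/
theorem WellBehaved.exists_card_zeros_density_le (hS : S.WellBehaved θ A C)
    (hZ : S.IsZeta θ A Z) (h : S.MomentBound θ) {D δ : ℝ}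
    (hD0 : 0 < D) (hD : ∀ u : ℝ, 1 ≤ u → (S.Nint u : ℝ) ≤ D * u) (hδ : 0 < δ) {m n : ℕ}
    (hm : 1 ≤ m) (hmn : m + (m + n) = m ^ 2) (hmθ : 4 ≤ (m - 1 : ℝ) * (1 - θ))
    (hmδ : 8 ≤ m * δ) :
    ∃ K > 0, ∀ (F : Finset ℂ) (α T Q : ℝ), (1 + θ) / 2 ≤ α → α ≤ 1 → 2 ≤ T → 2 ≤ Q →
      8 * (D * (C + A)) ≤ Q → T ≤ Q ^ (m ^ 2 * (1 - θ)) →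
      (∀ ρ ∈ F, Z ρ = 0 ∧ α ≤ ρ.re ∧ |ρ.im| ≤ T) →
        (F.card : ℝ) ≤ K * Q ^ (m ^ 2 * (2 * (1 - α) + 2 * δ)) := by
  classical
  obtain ⟨K₁, hK₁, h₁⟩ := hS.exists_card_zeros_le hZ
  obtain ⟨K₂, hK₂, h₂⟩ := hS.exists_card_zeros_tail_le hZ hD0 hm hmn
  obtain ⟨K₃, hK₃, h₃⟩ := hS.exists_card_zeros_block_le hZ h hm
  refine ⟨K₁ * 3 + K₂ + m ^ 2 * K₃, by positivity, fun F α T Q hα hα1 hT hQ hQD hTQ hF => ?_⟩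
  have hQ0 : 0 < Q := by linarith
  have hQ1 : 1 ≤ Q := by linarith
  have hm' : (1 : ℝ) ≤ m := by exact_mod_cast hm
  set H := Q ^ (m ^ 2 * (1 - α) + m ^ 2 * δ) with hH
  set W := Q ^ (m ^ 2 * (2 * (1 - α) + 2 * δ)) with hW
  have hHW : H * H = W := by
    rw [hH, hW, ← Real.rpow_add hQ0]
    ring_nf
  have hH1 : 1 ≤ H := by
    refine Real.one_le_rpow hQ1 ?_
    have := sub_nonneg.2 hα1
    positivity
  have hQW : Q ^ (m ^ 2 * (2 * (1 - α) + 15 / m)) ≤ W := by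
    refine Real.rpow_le_rpow_of_exponent_le hQ1 ?_
    gcongr
    rw [div_le_iff₀ (by linarith)]
    linarith
  let Flow := F.filter fun ρ => |ρ.im| ≤ H
  let Ftail := F.filter fun ρ =>
    1 / 8 ≤ D * Q ^ m * (‖ρ‖ * ‖tailMellin (S.err A) (Q ^ (m + n)) ρ‖)
  let Fblock : ℕ → Finset ℂ := fun i => F.filter fun ρ => 1 / (2 * m ^ 2) ≤ ‖S.dirichletEval ρ
    (S.block (S.remainder (Q ^ m) (Q ^ (m + n))) (Q ^ i) (Q ^ (i + 1)))‖
  have hsub : F ⊆ Flow ∪ Ftail ∪ (Finset.Ico m (m ^ 2)).biUnion Fblock := by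
    intro ρ hρ
    obtain ⟨h0, hre, -⟩ := hF ρ hρ
    simp only [Flow, Ftail, Fblock, Finset.mem_union, Finset.mem_biUnion, Finset.mem_filter, hρ,
      true_and]
    rcases le_total |ρ.im| H with him | him
    · exact Or.inl (Or.inl him)
    · rcases tail_or_block_large_of_zero hS hZ hD0 hD hQ1 hQD hm hmn hmθ hmδ h0 hα hα1 hre him
        with h | h
      · exact Or.inl (Or.inr h)
      · exact Or.inr h
  have hlow : (Flow.card : ℝ) ≤ K₁ * 3 * W := by
    refine (h₁ H Flow hH1 fun ρ hρ => ?_).trans ?_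
    · obtain ⟨hρ, him⟩ := Finset.mem_filter.1 hρ
      exact ⟨(hF ρ hρ).1, hα.trans (hF ρ hρ).2.1, him⟩
    · have hlog : Real.log (H + 3) ≤ 3 * H :=
        (Real.log_le_sub_one_of_pos (by linarith)).trans (by linarith)
      calc K₁ * H * Real.log (H + 3) ≤ K₁ * H * (3 * H) := by gcongr
        _ = K₁ * 3 * W := by
          rw [← hHW]
          ring
  have htail : (Ftail.card : ℝ) ≤ K₂ * W := by
    refine (h₂ Ftail α T Q hα hα1 hT hQ hTQ fun ρ hρ => ?_).trans (by gcongr)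
    obtain ⟨hρ, h⟩ := Finset.mem_filter.1 hρ
    exact ⟨(hF ρ hρ).1, (hF ρ hρ).2.1, (hF ρ hρ).2.2, h⟩
  have hblock : ∀ i ∈ Finset.Ico m (m ^ 2), ((Fblock i).card : ℝ) ≤ K₃ * W := by
    intro i hi
    rw [Finset.mem_Ico] at hi
    refine (h₃ (S.remainder (Q ^ m) (Q ^ (m + n))) (Fblock i) α T Q i hα hT hQ hTQ
      hi.1 hi.2.le
      (norm_coeff_remainder_le hS (one_le_pow₀ hQ1) (one_le_pow₀ hQ1)) fun ρ hρ => ?_).trans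
      (by gcongr)
    obtain ⟨hρ, h⟩ := Finset.mem_filter.1 hρ
    exact ⟨(hF ρ hρ).1, (hF ρ hρ).2.1, (hF ρ hρ).2.2, h⟩
  have hcard : F.card ≤ Flow.card + Ftail.card + ∑ i ∈ Finset.Ico m (m ^ 2), (Fblock i).card :=
    (Finset.card_le_card hsub).trans <| (Finset.card_union_le _ _).trans <|
      add_le_add (Finset.card_union_le _ _) Finset.card_biUnion_le
  have hblocks : ∑ i ∈ Finset.Ico m (m ^ 2), ((Fblock i).card : ℝ) ≤ m ^ 2 * (K₃ * W) := by
    refine (Finset.sum_le_card_nsmul _ _ _ hblock).trans ?_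
    rw [Nat.card_Ico, nsmul_eq_mul]
    have : ((m ^ 2 - m : ℕ) : ℝ) ≤ m ^ 2 := by exact_mod_cast Nat.sub_le _ _
    gcongr
  have hcard' : (F.card : ℝ) ≤ Flow.card + Ftail.card +
      ∑ i ∈ Finset.Ico m (m ^ 2), ((Fblock i).card : ℝ) := by exact_mod_cast hcard
  linarith

/-- The density hypothesis for finite sets of zeros. -/
theorem WellBehaved.exists_card_zeros_density_hypothesis (hS : S.WellBehaved θ A C)
    (hZ : S.IsZeta θ A Z) (h : S.MomentBound θ) {ε : ℝ} (hε : 0 < ε) :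
    ∃ K > 0, ∀ (F : Finset ℂ) (α T : ℝ), (1 + θ) / 2 ≤ α → α ≤ 1 → 2 ≤ T →
      (∀ ρ ∈ F, Z ρ = 0 ∧ α ≤ ρ.re ∧ |ρ.im| ≤ T) →
        (F.card : ℝ) ≤ K * T ^ (2 * (1 - α) / (1 - θ) + ε) := by
  have hθ : 0 < 1 - θ := sub_pos.2 hS.lt_one
  obtain ⟨D, hD0, hD⟩ := exists_Nint_le hS.lt_one hS.density_pos hS.const_pos hS.abs_sub_le
  have hδ : 0 < ε * (1 - θ) / 2 := by positivity
  set δ := ε * (1 - θ) / 2 with hδdef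
  obtain ⟨m, hm⟩ := exists_nat_ge (max (max 2 (8 / δ)) (1 + 4 / (1 - θ)))
  simp only [max_le_iff] at hm
  obtain ⟨⟨hm2, hmδ⟩, hmθ⟩ := hm
  have hm2' : 2 ≤ m := by exact_mod_cast hm2
  rw [div_le_iff₀ hδ] at hmδ
  have hmθ' : 4 ≤ (m - 1 : ℝ) * (1 - θ) := by
    rw [← div_le_iff₀ hθ]
    linarith
  obtain ⟨n, hn⟩ : ∃ n, m ^ 2 = m * 2 + n :=
    Nat.exists_eq_add_of_le (by rw [sq]; exact Nat.mul_le_mul_left m hm2')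
  obtain ⟨K₁, hK₁, h₁⟩ := hS.exists_card_zeros_le hZ
  obtain ⟨K₂, hK₂, h₂⟩ := hS.exists_card_zeros_density_le hZ h hD0 hD hδ (m := m) (n := n)
    (by lia) (by lia) hmθ' hmδ
  set e : ℝ := m ^ 2 * (1 - θ) with he
  have he0 : 0 < e := by positivity
  set Q₀ := max 2 (8 * (D * (C + A))) with hQ₀
  have hQ₀2 : 2 ≤ Q₀ := le_max_left _ _
  have hT₀ : 1 ≤ Q₀ ^ e := Real.one_le_rpow (by linarith) he0.le
  have hlog : 0 ≤ Real.log (Q₀ ^ e + 3) := Real.log_nonneg (by linarith)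
  refine ⟨K₁ * Q₀ ^ e * Real.log (Q₀ ^ e + 3) + K₂, by positivity,
    fun F α T hα hα1 hT hF => ?_⟩
  have hT0 : 0 < T := by linarith
  have hα0 := sub_nonneg.2 hα1
  rw [add_mul]
  rcases le_total T (Q₀ ^ e) with hTT | hTT
  · have hW : 1 ≤ T ^ (2 * (1 - α) / (1 - θ) + ε) :=
      Real.one_le_rpow (by linarith) (by positivity)
    calc (F.card : ℝ) ≤ K₁ * Q₀ ^ e * Real.log (Q₀ ^ e + 3) :=
          h₁ _ F hT₀ fun ρ hρ => ⟨(hF ρ hρ).1, hα.trans (hF ρ hρ).2.1, (hF ρ hρ).2.2.trans hTT⟩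
      _ ≤ K₁ * Q₀ ^ e * Real.log (Q₀ ^ e + 3) * T ^ (2 * (1 - α) / (1 - θ) + ε) :=
          le_mul_of_one_le_right (by positivity) hW
      _ ≤ _ := le_add_of_nonneg_right (by positivity)
  · have hQQ : Q₀ ≤ T ^ e⁻¹ := (Real.le_rpow_inv_iff_of_pos (by linarith) hT0.le he0).2 hTT
    have hQT : (T ^ e⁻¹) ^ e = T := Real.rpow_inv_rpow hT0.le he0.ne'
    calc (F.card : ℝ) ≤ K₂ * (T ^ e⁻¹) ^ (m ^ 2 * (2 * (1 - α) + 2 * δ)) :=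
          h₂ F α T _ hα hα1 hT (hQ₀2.trans hQQ) ((le_max_right _ _).trans hQQ) hQT.ge hF
      _ = K₂ * T ^ (2 * (1 - α) / (1 - θ) + ε) := by
          rw [← Real.rpow_mul hT0.le]
          congr 2
          rw [he, hδdef]
          field_simp
      _ ≤ _ := le_add_of_nonneg_left (by positivity)

end BeurlingSystem

end

/-- Section 5.3: the Montgomery-type conjecture for general Dirichlet polynomials over
a `θ`-well-behaved Beurling system implies the density hypothesis
`N(ζ_𝒫; α, T) ≪_ε T^{2(1-α)/(1-θ)+ε}`. -/
theorem montgomery_conjecture_implies_density_hypothesis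
    (θ : ℝ) (hθ0 : 0 ≤ θ) (hθ1 : θ < 1) (S : BeurlingSystem)
    (A : ℝ) (hA : 0 < A)
    (hwb : (fun x : ℝ => (S.Nint x : ℝ) - A * x) =O[atTop] fun x : ℝ => x ^ θ)
    (Z : ℂ → ℂ) (hZ : S.IsZeta θ A Z)
    (hconj : ∀ ε > (0:ℝ), ∃ Cε : ℝ, ∀ (a : ℕ → ℂ) (N T₀ T ν : ℝ),
      (∀ j, ‖a j‖ ≤ 1) → 2 ≤ N → 0 < T → 1 ≤ ν → ν ≤ 2 →
      (∫ t in T₀..T₀ + T,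
          ‖∑' j : ℕ, Set.indicator {j : ℕ | S.n j ≤ N}
            (fun j => a j * (S.n j : ℂ) ^ (-(Complex.I * (t : ℂ)))) j‖ ^ (2 * ν))
        ≤ Cε * (T * N ^ (ν * θ) + N ^ ν) * N ^ (ν + ε)) :
    ∀ ε > (0:ℝ), ∃ C : ℝ, ∀ α T : ℝ, (1 + θ) / 2 ≤ α → 2 ≤ T →
      (zeroCount Z α T : ℝ) ≤ C * T ^ (2 * (1 - α) / (1 - θ) + ε) := by
  intro ε hε
  have hfin := S.finite_setOf_n_le hθ1 hA hwb
  obtain ⟨C, hC, hE⟩ := S.exists_abs_Nint_sub_le hθ0 hA hfin hwb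
  have hS : S.WellBehaved θ A C := ⟨hθ0, hθ1, hA, hC, hfin, hE⟩
  obtain ⟨K, hK, h⟩ := hS.exists_card_zeros_density_hypothesis hZ hconj hε
  refine ⟨K, fun α T hα hT => ?_⟩
  have hnonneg : 0 ≤ K * T ^ (2 * (1 - α) / (1 - θ) + ε) := by positivity
  rw [zeroCount]
  by_cases hzeros : {ρ : ℂ | Z ρ = 0 ∧ α ≤ ρ.re ∧ |ρ.im| ≤ T}.Finite
  · rcases le_or_gt α 1 with hα1 | hα1
    · rw [Set.ncard_eq_toFinset_card _ hzeros]
      exact h _ α T hα hα1 hT fun ρ hρ => hzeros.mem_toFinset.1 hρ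
    · have hempty : {ρ : ℂ | Z ρ = 0 ∧ α ≤ ρ.re ∧ |ρ.im| ≤ T} = ∅ :=
        Set.eq_empty_of_forall_notMem fun ρ hρ =>
          hS.ne_zero_of_one_lt_re hZ (hα1.trans_le hρ.2.1) hρ.1
      rwa [hempty, Set.ncard_empty, Nat.cast_zero]
  · rwa [Set.Infinite.ncard hzeros, Nat.cast_zero]
end

section
/- For every positive integer m and every real number u > 1, ∑_{k ∣ m} μ(k) u^{1/k} > 0, where μ denotes the classical Möbius function and the sum runs over the positive divisors k of m. -/
open ArithmeticFunction in
/-- For multiplicative `g`, `∑_{d ∣ n} μ(d) g(d)` is the product of `1 - g(p)` over the primes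
dividing `n`. -/
theorem sum_divisors_moebius_mul_eq_prod_primeFactors {R : Type*} [CommRing R]
    {g : ArithmeticFunction R} (hg : g.IsMultiplicative) {n : ℕ} (hn : n ≠ 0) :
    ∑ d ∈ n.divisors, (moebius d : R) * g d = ∏ p ∈ n.primeFactors, (1 - g p) := by
  have hF : (((moebius : ArithmeticFunction R).pmul g) * (zeta : ArithmeticFunction R)
      ).IsMultiplicative :=
    (isMultiplicative_moebius.intCast.pmul hg).mul isMultiplicative_zeta.natCast
  have h := hF.multiplicative_factorization _ hn
  simp only [coe_mul_zeta_apply, pmul_apply, intCoe_apply] at h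
  rw [h, Nat.prod_factorization_eq_prod_primeFactors]
  refine Finset.prod_congr rfl fun p hp => ?_
  have hpp := Nat.prime_of_mem_primeFactors hp
  obtain ⟨a, ha⟩ := Nat.exists_eq_succ_of_ne_zero
    (hpp.factorization_pos_of_dvd hn (Nat.dvd_of_mem_primeFactors hp)).ne'
  rw [ha, Nat.sum_divisors_prime_pow hpp, Finset.sum_range_succ', Finset.sum_range_succ',
    Finset.sum_eq_zero]
  · simp [moebius_apply_prime hpp, hg.1]
    ring
  · intro i _
    rw [moebius_apply_prime_pow hpp (by lia), if_neg (by lia)]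
    simp

theorem sum_divisors_moebius_mul_inv_pow {K : Type*} [Field K] {n : ℕ} (hn : n ≠ 0) (j : ℕ) :
    ∑ d ∈ n.divisors, (ArithmeticFunction.moebius d : K) * ((d : K)⁻¹) ^ j =
      ∏ p ∈ n.primeFactors, (1 - ((p : K)⁻¹) ^ j) := by
  let g : ArithmeticFunction K := ⟨fun d => if d = 0 then 0 else ((d : K)⁻¹) ^ j, by simp⟩
  have hg_apply {d : ℕ} (hd : d ≠ 0) : g d = ((d : K)⁻¹) ^ j := if_neg hd
  have hg : g.IsMultiplicative := by
    rw [ArithmeticFunction.IsMultiplicative.iff_ne_zero]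
    refine ⟨by simp [hg_apply], fun {a b} ha hb _ => ?_⟩
    rw [hg_apply ha, hg_apply hb, hg_apply (mul_ne_zero ha hb), Nat.cast_mul, mul_inv, mul_pow]
  rw [Finset.prod_congr rfl fun p hp => by
      rw [← hg_apply (Nat.prime_of_mem_primeFactors hp).ne_zero],
    ← sum_divisors_moebius_mul_eq_prod_primeFactors hg hn]
  exact Finset.sum_congr rfl fun d hd => by rw [hg_apply (Nat.pos_of_mem_divisors hd).ne']

/-- Lemma 6.1: for every positive integer `m` and real `u > 1`,
`∑_{k ∣ m} μ(k) u^{1/k} > 0`. -/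
theorem moebius_divisor_sum_pos (m : ℕ) (hm : 0 < m) (u : ℝ) (hu : 1 < u) :
    0 < ∑ k ∈ m.divisors, (ArithmeticFunction.moebius k : ℝ) * u ^ ((1 : ℝ) / (k : ℝ)) := by
  have ht : 0 < Real.log u := Real.log_pos hu
  have hsum : HasSum (fun j : ℕ => Real.log u ^ j / (j.factorial : ℝ) *
      ∏ p ∈ m.primeFactors, (1 - ((p : ℝ)⁻¹) ^ j))
      (∑ k ∈ m.divisors, (ArithmeticFunction.moebius k : ℝ) * u ^ ((1 : ℝ) / (k : ℝ))) := by
    have h := hasSum_sum fun k (_ : k ∈ m.divisors) =>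
      (NormedSpace.expSeries_div_hasSum_exp (Real.log u * (k : ℝ)⁻¹)).mul_left
        (ArithmeticFunction.moebius k : ℝ)
    rw [← Real.exp_eq_exp_ℝ] at h
    convert! h using 1
    · funext j
      rw [← sum_divisors_moebius_mul_inv_pow hm.ne', Finset.mul_sum]
      exact Finset.sum_congr rfl fun k _ => by rw [mul_pow]; ring
    · exact Finset.sum_congr rfl fun k _ => by
        rw [Real.rpow_def_of_pos (by linarith), one_div]
  have hinv {p : ℕ} (hp : p ∈ m.primeFactors) : (p : ℝ)⁻¹ < 1 :=
    inv_lt_one_of_one_lt₀ (by exact_mod_cast (Nat.prime_of_mem_primeFactors hp).one_lt)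
  have hnonneg (j : ℕ) : 0 ≤ Real.log u ^ j / (j.factorial : ℝ) *
      ∏ p ∈ m.primeFactors, (1 - ((p : ℝ)⁻¹) ^ j) :=
    mul_nonneg (by positivity) <| Finset.prod_nonneg fun p hp =>
      sub_nonneg.2 (pow_le_one₀ (by positivity) (hinv hp).le)
  rw [← hsum.tsum_eq]
  refine hsum.summable.tsum_pos hnonneg 1 (mul_pos (by positivity) ?_)
  exact Finset.prod_pos fun p hp => by simpa using hinv hp
end
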